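/- Let n ≥ 2 and 1 ≤ p ≤ (2n+2)/(n+3), with 1/p + 1/p' = 1. Then for every r > 0 there is a constant C_r > 0 such that for all Schwartz functions f on ℝⁿ, ||f * (dσ_r)^∨||_{L^{p'}(ℝⁿ)} ≤ C_r ||f||_{L^p(ℝⁿ)}, where dσ_r is the surface measure on the sphere of radius r in ℝⁿ and (dσ_r)^∨(x) = ∫_{|ξ|=r} e^{iξ·x} dσ_r(ξ). -/

import Mathlib

open MeasureTheory
open scoped ENNReal RealInnerProductSpace

noncomputable section

/-- surface measure on the unit sphere S^{n-1} -/
def sphereMeasure (n : ℕ) : Measure (Metric.sphere (0 : EuclideanSpace ℝ (Fin n)) 1) :=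
  (volume : Measure (EuclideanSpace ℝ (Fin n))).toSphere

/-- the Fourier transform f̂(ξ) = ∫ f(x) e^{-i ξ·x} dx -/
def fourierTr (n : ℕ) (f : EuclideanSpace ℝ (Fin n) → ℂ) (ξ : EuclideanSpace ℝ (Fin n)) : ℂ :=
  ∫ x : EuclideanSpace ℝ (Fin n), f x * Complex.exp (-Complex.I * (⟪ξ, x⟫ : ℝ))

end
noncomputable section

/-- surface measure on the sphere of radius r -/
def sphereMeasureR (n : ℕ) (r : ℝ) : Measure (EuclideanSpace ℝ (Fin n)) :=
  ENNReal.ofReal (r ^ (n - 1)) •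
    Measure.map (fun ε : Metric.sphere (0 : EuclideanSpace ℝ (Fin n)) 1 =>
      r • (ε : EuclideanSpace ℝ (Fin n))) (sphereMeasure n)

/-- inverse Fourier transform of the surface measure dσ_r -/
def invFTsphere (n : ℕ) (r : ℝ) (x : EuclideanSpace ℝ (Fin n)) : ℂ :=
  ∫ ξ, Complex.exp (Complex.I * (⟪ξ, x⟫ : ℝ)) ∂(sphereMeasureR n r)

end

noncomputable section

/-- A measure on `ℝⁿ` carried by the sphere of radius `R` and invariant under linear isometries. -/
structure IsSpherical {n : ℕ} (ν : Measure (EuclideanSpace ℝ (Fin n))) (R : ℝ) : Prop where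
  norm_eq : ∀ᵐ ω ∂ν, ‖ω‖ = R
  map_eq : ∀ L : EuclideanSpace ℝ (Fin n) ≃ₗᵢ[ℝ] EuclideanSpace ℝ (Fin n), ν.map L = ν

namespace IsSpherical

variable {n : ℕ} {ν : Measure (EuclideanSpace ℝ (Fin n))} {R : ℝ}

theorem integral_comp_isometry (hν : IsSpherical ν R)
    (L : EuclideanSpace ℝ (Fin n) ≃ₗᵢ[ℝ] EuclideanSpace ℝ (Fin n))
    {G : Type*} [NormedAddCommGroup G] [NormedSpace ℝ G] (F : EuclideanSpace ℝ (Fin n) → G) :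
    ∫ ω, F (L ω) ∂ν = ∫ ω, F ω ∂ν := by
  conv_rhs => rw [← hν.map_eq L]
  exact (L.toHomeomorph.measurableEmbedding.integral_map F).symm

theorem integrable_of_continuous [IsFiniteMeasure ν] (hν : IsSpherical ν R)
    {G : Type*} [NormedAddCommGroup G]
    {F : EuclideanSpace ℝ (Fin n) → G} (hF : Continuous F) : Integrable F ν := by
  obtain ⟨C, hC⟩ :=
    (isCompact_closedBall (0 : EuclideanSpace ℝ (Fin n)) R).exists_bound_of_continuousOn
    hF.continuousOn
  refine Integrable.of_bound hF.aestronglyMeasurable C ?_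
  filter_upwards [hν.norm_eq] with ω hω
  exact hC ω (by simp [hω])

theorem abs_apply_le (i : Fin n) {ω : EuclideanSpace ℝ (Fin n)} (hω : ‖ω‖ = R) : |ω i| ≤ R := by
  have := PiLp.norm_apply_le ω i
  simpa [hω] using this

theorem integral_rotate (hν : IsSpherical ν R) {i j : Fin n} (hij : i ≠ j) (F : ℝ → ℝ → ℝ)
    (α : ℝ) :
    ∫ ω, F (ω i * Real.cos α + ω j * Real.sin α) (ω i * Real.sin α - ω j * Real.cos α) ∂ν
      = ∫ ω, F (ω i) (ω j) ∂ν := by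
  set u : EuclideanSpace ℝ (Fin n) :=
    EuclideanSpace.single i (Real.cos (α / 2)) + EuclideanSpace.single j (Real.sin (α / 2)) with hu
  have hui : u i = Real.cos (α / 2) := by simp [hu, hij]
  have huj : u j = Real.sin (α / 2) := by simp [hu, hij.symm]
  have hin : ∀ ω : EuclideanSpace ℝ (Fin n),
      ⟪u, ω⟫ = Real.cos (α / 2) * ω i + Real.sin (α / 2) * ω j := by
    intro ω
    rw [hu, inner_add_left, EuclideanSpace.inner_single_left, EuclideanSpace.inner_single_left]
    simp
  have hnorm : ‖u‖ ^ 2 = 1 := by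
    rw [← real_inner_self_eq_norm_sq, hin, hui, huj]
    nlinarith [Real.sin_sq_add_cos_sq (α / 2)]
  have hc : Real.cos α = 2 * Real.cos (α / 2) ^ 2 - 1 := by
    rw [← Real.cos_two_mul]; ring_nf
  have hs : Real.sin α = 2 * Real.sin (α / 2) * Real.cos (α / 2) := by
    rw [← Real.sin_two_mul]; ring_nf
  have hsc := Real.sin_sq_add_cos_sq (α / 2)
  rw [← hν.integral_comp_isometry (ℝ ∙ u).reflection (fun ω => F (ω i) (ω j))]
  congr 1
  ext ω
  simp only [Submodule.reflection_singleton_apply, hin]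
  have h1 : ((‖u‖ : ℝ) : ℝ) ^ 2 = 1 := hnorm
  simp only [RCLike.ofReal_real_eq_id, id, h1, PiLp.sub_apply, PiLp.smul_apply, hui, huj,
    smul_eq_mul, nsmul_eq_mul]
  congr 1
  · rw [hc, hs]; push_cast; ring
  · rw [hc, hs]; push_cast; linear_combination (-2 * ω j) * hsc

theorem integral_by_parts_pair [IsFiniteMeasure ν] (hν : IsSpherical ν R) {i j : Fin n}
    (hij : i ≠ j) {φ φ' : ℝ → ℝ} (hφ : ∀ x, HasDerivAt φ (φ' x) x) (hφ' : Continuous φ') :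
    ∫ ω, (ω i * φ (ω i) - ω j ^ 2 * φ' (ω i)) ∂ν = 0 := by
  have hφc : Continuous φ := continuous_iff_continuousAt.2 fun x => (hφ x).continuousAt
  set F : ℝ → EuclideanSpace ℝ (Fin n) → ℝ := fun α ω =>
    (ω i * Real.sin α - ω j * Real.cos α) * φ (ω i * Real.cos α + ω j * Real.sin α) with hF
  set F' : ℝ → EuclideanSpace ℝ (Fin n) → ℝ := fun α ω =>
    (ω i * Real.cos α + ω j * Real.sin α) * φ (ω i * Real.cos α + ω j * Real.sin α) +
    (ω i * Real.sin α - ω j * Real.cos α) *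
      (φ' (ω i * Real.cos α + ω j * Real.sin α) * (-(ω i * Real.sin α) + ω j * Real.cos α))
    with hF'
  have hcont : Continuous fun q : ℝ × EuclideanSpace ℝ (Fin n) => F' q.1 q.2 := by
    simp only [hF']; fun_prop
  obtain ⟨C, hC⟩ := ((isCompact_Icc (a := (-1 : ℝ)) (b := 1)).prod
    (isCompact_closedBall (0 : EuclideanSpace ℝ (Fin n)) R)).exists_bound_of_continuousOn
    hcont.continuousOn
  have hFc : ∀ α, Continuous (F α) := by intro α; simp only [hF]; fun_prop
  have hFc' : Continuous (F' 0) := hcont.comp (by fun_prop : Continuous fun ω => ((0 : ℝ), ω))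
  have key := (hasDerivAt_integral_of_dominated_loc_of_deriv_le (μ := ν) (F := F) (F' := F')
    (x₀ := (0 : ℝ)) (s := Set.Icc (-1) 1) (bound := fun _ => C)
    (Icc_mem_nhds (by norm_num) (by norm_num))
    (Filter.Eventually.of_forall fun α => (hFc α).aestronglyMeasurable)
    (hν.integrable_of_continuous (hFc 0)) hFc'.aestronglyMeasurable
    (by
      filter_upwards [hν.norm_eq] with ω hω α hα
      exact hC (α, ω) ⟨hα, by simp [hω]⟩)
    (integrable_const _)
    (by
      refine Filter.Eventually.of_forall fun ω α _ => ?_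
      have h1 : HasDerivAt (fun α => ω i * Real.sin α - ω j * Real.cos α)
          (ω i * Real.cos α + ω j * Real.sin α) α := by
        have := ((Real.hasDerivAt_sin α).const_mul (ω i)).sub
          ((Real.hasDerivAt_cos α).const_mul (ω j))
        refine this.congr_deriv ?_
        ring
      have h2 : HasDerivAt (fun α => ω i * Real.cos α + ω j * Real.sin α)
          (-(ω i * Real.sin α) + ω j * Real.cos α) α := by
        have := ((Real.hasDerivAt_cos α).const_mul (ω i)).add
          ((Real.hasDerivAt_sin α).const_mul (ω j))
        refine this.congr_deriv ?_
        ring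
      exact h1.mul ((hφ _).comp α h2))).2
  have hconst : (fun α => ∫ ω, F α ω ∂ν) = fun _ => ∫ ω, ω j * φ (ω i) ∂ν := by
    ext α
    exact hν.integral_rotate hij (fun a b => b * φ a) α
  rw [hconst] at key
  have h0 := key.unique (hasDerivAt_const _ _)
  rw [← h0]
  congr 1
  ext ω
  simp [hF']
  ring

theorem integral_by_parts [IsFiniteMeasure ν] (hν : IsSpherical ν R) (i : Fin n)
    {φ φ' : ℝ → ℝ} (hφ : ∀ x, HasDerivAt φ (φ' x) x) (hφ' : Continuous φ') :
    ∫ ω, (((n : ℝ) - 1) * ω i * φ (ω i) - (R ^ 2 - ω i ^ 2) * φ' (ω i)) ∂ν = 0 := by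
  have hφc : Continuous φ := continuous_iff_continuousAt.2 fun x => (hφ x).continuousAt
  have h1 : ∀ᵐ ω ∂ν, (((n : ℝ) - 1) * ω i * φ (ω i) - (R ^ 2 - ω i ^ 2) * φ' (ω i))
      = ∑ j ∈ Finset.univ.erase i, (ω i * φ (ω i) - ω j ^ 2 * φ' (ω i)) := by
    filter_upwards [hν.norm_eq] with ω hω
    have h2 : R ^ 2 = ∑ j, ω j ^ 2 := by
      rw [← hω, EuclideanSpace.norm_sq_eq]; simp
    rw [Finset.sum_sub_distrib, h2, ← Finset.sum_erase_add _ _ (Finset.mem_univ i)]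
    have h3 : ((Finset.univ.erase i).card : ℝ) = (n : ℝ) - 1 := by
      rw [Finset.card_erase_of_mem (Finset.mem_univ i), Finset.card_univ, Fintype.card_fin,
        Nat.cast_sub (Nat.one_le_iff_ne_zero.2 (fun h => by subst h; exact i.elim0))]
      simp
    rw [Finset.sum_const, nsmul_eq_mul, h3, ← Finset.sum_mul _ _ (φ' (ω i))]
    ring
  rw [integral_congr_ae h1, integral_finsetSum]
  · refine Finset.sum_eq_zero fun j hj => ?_
    exact hν.integral_by_parts_pair (Finset.ne_of_mem_erase hj).symm hφ hφ'
  · intro j _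
    exact hν.integrable_of_continuous (by fun_prop)

end IsSpherical

theorem hasDerivAt_rpow_div {x : ℝ} (hx : 0 < x) (a : ℝ) :
    HasDerivAt (fun y : ℝ => y ^ a) (x ^ a * (a / x)) x := by
  refine (Real.hasDerivAt_rpow_const (Or.inl hx.ne')).congr_deriv ?_
  rw [Real.rpow_sub_one hx.ne']
  ring

theorem hasDerivAt_exp_div {x : ℝ} (hx : 0 < x) (a : ℝ) :
    HasDerivAt (fun y : ℝ => Real.exp (a / y)) (Real.exp (a / x) * (-(a / x ^ 2))) x := by
  have h : HasDerivAt (fun y : ℝ => a / y) (-(a / x ^ 2)) x := by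
    refine ((hasDerivAt_inv hx.ne').const_mul a).congr_deriv ?_
    ring
  exact h.exp

theorem le_of_mul_exp_deriv_nonpos {f f' : ℝ → ℝ} {A : ℝ} (hA : 0 ≤ A)
    (hf0 : ∀ x, 0 < x → 0 ≤ f x)
    (hf : ∀ x, 0 < x → HasDerivAt f (f' x) x) (hle : ∀ x, 0 < x → f' x ≤ A / x ^ 2 * f x)
    {x : ℝ} (hx : 1 ≤ x) : f x ≤ f 1 * Real.exp A := by
  have hd : ∀ y, 0 < y → HasDerivAt (fun y => f y * Real.exp (A / y))
      (f' y * Real.exp (A / y) + f y * (Real.exp (A / y) * (-(A / y ^ 2)))) y :=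
    fun y hy => (hf y hy).mul (hasDerivAt_exp_div hy A)
  have hanti : AntitoneOn (fun y => f y * Real.exp (A / y)) (Set.Ici 1) := by
    refine antitoneOn_of_deriv_nonpos (convex_Ici 1) ?_ ?_ ?_
    · intro y hy
      exact (hd y (lt_of_lt_of_le one_pos hy)).continuousAt.continuousWithinAt
    · intro y hy
      rw [interior_Ici] at hy
      exact (hd y (one_pos.trans hy)).differentiableAt.differentiableWithinAt
    · intro y hy
      rw [interior_Ici] at hy
      have hy0 : 0 < y := one_pos.trans hy
      rw [(hd y hy0).deriv]
      have := hle y hy0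
      have he := (Real.exp_pos (A / y)).le
      nlinarith [mul_le_mul_of_nonneg_right this he]
  have h1 := hanti (Set.mem_Ici.2 le_rfl) (Set.mem_Ici.2 hx) hx
  simp only [div_one] at h1
  refine le_trans ?_ h1
  have hx0 : 0 < x := one_pos.trans_le hx
  exact le_mul_of_one_le_right (hf0 x hx0) (Real.one_le_exp (by positivity))

namespace IsSpherical

variable {n : ℕ} {ν : Measure (EuclideanSpace ℝ (Fin n))} {R : ℝ}

theorem hasDerivAt_integral [IsFiniteMeasure ν] (hν : IsSpherical ν R)
    {F F' : ℝ → EuclideanSpace ℝ (Fin n) → ℝ} (hFc : ∀ x, Continuous (F x))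
    (hF' : Continuous fun q : ℝ × EuclideanSpace ℝ (Fin n) => F' q.1 q.2)
    (hF : ∀ x ω, HasDerivAt (fun y => F y ω) (F' x ω) x) (x : ℝ) :
    HasDerivAt (fun y => ∫ ω, F y ω ∂ν) (∫ ω, F' x ω ∂ν) x := by
  obtain ⟨C, hC⟩ := ((isCompact_Icc (a := x - 1) (b := x + 1)).prod
    (isCompact_closedBall (0 : EuclideanSpace ℝ (Fin n)) R)).exists_bound_of_continuousOn
    hF'.continuousOn
  have hFc' : Continuous (F' x) := hF'.comp (by fun_prop : Continuous fun ω => (x, ω))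
  refine (hasDerivAt_integral_of_dominated_loc_of_deriv_le (μ := ν) (F := F) (F' := F')
    (x₀ := x) (s := Set.Icc (x - 1) (x + 1)) (bound := fun _ => C)
    (Icc_mem_nhds (by linarith) (by linarith))
    (Filter.Eventually.of_forall fun α => (hFc α).aestronglyMeasurable)
    (hν.integrable_of_continuous (hFc x)) hFc'.aestronglyMeasurable ?_
    (integrable_const _) (Filter.Eventually.of_forall fun ω y _ => hF y ω)).2
  filter_upwards [hν.norm_eq] with ω hω α hα
  exact hC (α, ω) ⟨hα, by simp [hω]⟩

/-- The Laplace transform of a zonal marginal of `ν`, measured from the pole. -/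
def laplace (ν : Measure (EuclideanSpace ℝ (Fin n))) (R : ℝ) (i : Fin n) (l : ℝ) : ℝ :=
  ∫ ω, Real.exp (-(l * (R - ω i))) ∂ν

/-- The logarithmic derivative `l ^ (1 - m) * d/dl (l ^ m * laplace ν R i l)`. -/
def laplaceDeriv (ν : Measure (EuclideanSpace ℝ (Fin n))) (R : ℝ) (i : Fin n) (m l : ℝ) : ℝ :=
  ∫ ω, (m - l * (R - ω i)) * Real.exp (-(l * (R - ω i))) ∂ν

theorem laplace_nonneg (i : Fin n) (l : ℝ) : 0 ≤ laplace ν R i l :=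
  integral_nonneg fun _ => (Real.exp_pos _).le

theorem ae_sub_nonneg (hν : IsSpherical ν R) (i : Fin n) : ∀ᵐ ω ∂ν, 0 ≤ R - ω i := by
  filter_upwards [hν.norm_eq] with ω hω
  linarith [(abs_le.1 (abs_apply_le i hω)).2]

theorem laplace_le_measure [IsFiniteMeasure ν] (hν : IsSpherical ν R) (i : Fin n) {l : ℝ}
    (hl : 0 ≤ l) : laplace ν R i l ≤ ν.real Set.univ := by
  have : laplace ν R i l ≤ ∫ _, (1 : ℝ) ∂ν := by
    refine integral_mono_ae (hν.integrable_of_continuous (by fun_prop)) (integrable_const _) ?_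
    filter_upwards [hν.ae_sub_nonneg i] with ω hω
    exact Real.exp_le_one_iff.2 (by nlinarith)
  simpa using this

theorem hasDerivAt_laplace [IsFiniteMeasure ν] (hν : IsSpherical ν R) (i : Fin n) (m : ℝ) {l : ℝ}
    (hl : l ≠ 0) : HasDerivAt (laplace ν R i)
      ((laplaceDeriv ν R i m l - m * laplace ν R i l) / l) l := by
  have h := hν.hasDerivAt_integral (F := fun l ω => Real.exp (-(l * (R - ω i))))
    (F' := fun l ω => Real.exp (-(l * (R - ω i))) * (-(R - ω i)))
    (by intro x; fun_prop) (by fun_prop)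
    (by
      intro x ω
      have : HasDerivAt (fun y : ℝ => -(y * (R - ω i))) (-(R - ω i)) x := by
        simpa using ((hasDerivAt_id x).mul_const (R - ω i)).fun_neg
      exact this.exp) l
  refine h.congr_deriv ?_
  rw [eq_div_iff hl, laplaceDeriv, laplace, ← integral_const_mul, ← integral_mul_const,
    ← integral_sub]
  · congr 1; ext ω; ring
  · exact hν.integrable_of_continuous (by fun_prop)
  · exact hν.integrable_of_continuous (by fun_prop)

theorem laplaceDeriv_eq [IsFiniteMeasure ν] (hν : IsSpherical ν R) (hR : 0 < R) (i : Fin n)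
    (l : ℝ) : laplaceDeriv ν R i (((n : ℝ) - 1) / 2) l =
      ∫ ω, (((n : ℝ) - 1) * (R - ω i) - l * (R - ω i) ^ 2) / (2 * R)
        * Real.exp (-(l * (R - ω i))) ∂ν := by
  have h := hν.integral_by_parts i (φ := fun u => Real.exp (-(l * (R - u))))
    (φ' := fun u => Real.exp (-(l * (R - u))) * l)
    (by
      intro x
      have : HasDerivAt (fun u : ℝ => -(l * (R - u))) l x := by
        simpa using (((hasDerivAt_id x).const_sub R).const_mul l).fun_neg
      exact this.exp) (by fun_prop)
  rw [laplaceDeriv, ← sub_eq_zero, ← integral_sub (hν.integrable_of_continuous (by fun_prop))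
    (hν.integrable_of_continuous (by fun_prop))]
  rw [← mul_zero (1 / (2 * R)), ← h, ← integral_const_mul]
  congr 1
  ext ω
  field_simp
  ring

theorem exists_laplace_le [IsFiniteMeasure ν] (hν : IsSpherical ν R) (hR : 0 < R) (hn : 1 ≤ n)
    (i : Fin n) :
    ∃ C, 0 ≤ C ∧ ∀ l, 0 < l → l ^ (((n : ℝ) - 1) / 2) * laplace ν R i l ≤ C := by
  set m : ℝ := ((n : ℝ) - 1) / 2 with hm
  have hm0 : 0 ≤ m := by
    have : (1 : ℝ) ≤ n := by exact_mod_cast hn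
    rw [hm]; linarith
  have hd : ∀ x, 0 < x → HasDerivAt (fun x => x ^ m * laplace ν R i x)
      (x ^ m * (laplaceDeriv ν R i m x / x)) x := by
    intro x hx
    refine ((hasDerivAt_rpow_div hx m).mul (hν.hasDerivAt_laplace i m hx.ne')).congr_deriv ?_
    ring
  have hle : ∀ x, 0 < x → x ^ m * (laplaceDeriv ν R i m x / x) ≤
      m ^ 2 / (2 * R) / x ^ 2 * (x ^ m * laplace ν R i x) := by
    intro x hx
    have h1 : laplaceDeriv ν R i m x ≤ m ^ 2 / (2 * R) / x * laplace ν R i x := by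
      rw [hm, hν.laplaceDeriv_eq hR, ← hm, laplace, ← integral_const_mul]
      refine integral_mono (hν.integrable_of_continuous (by fun_prop))
        (hν.integrable_of_continuous (by fun_prop)) fun ω => ?_
      refine mul_le_mul_of_nonneg_right ?_ (Real.exp_pos _).le
      rw [div_right_comm]
      refine div_le_div_of_nonneg_right ?_ (by positivity)
      rw [le_div_iff₀ hx]
      have : (n : ℝ) - 1 = 2 * m := by rw [hm]; ring
      rw [this]
      nlinarith [sq_nonneg (m - x * (R - ω i))]
    have h2 : m ^ 2 / (2 * R) / x ^ 2 * (x ^ m * laplace ν R i x) =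
        x ^ m * ((m ^ 2 / (2 * R) / x * laplace ν R i x) / x) := by
      field_simp
    rw [h2]
    gcongr
  refine ⟨1 ^ m * laplace ν R i 1 * Real.exp (m ^ 2 / (2 * R)) + ν.real Set.univ,
    by have := laplace_nonneg (ν := ν) (R := R) i 1; positivity, fun l hl => ?_⟩
  rcases le_total 1 l with h | h
  · have := le_of_mul_exp_deriv_nonpos (f := fun x => x ^ m * laplace ν R i x) (by positivity)
      (fun x hx => mul_nonneg (Real.rpow_nonneg hx.le _) (laplace_nonneg i x)) hd hle h
    have h0 : 0 ≤ ν.real Set.univ := measureReal_nonneg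
    linarith
  · have h1 : l ^ m ≤ 1 := Real.rpow_le_one hl.le h hm0
    have h2 := hν.laplace_le_measure i hl.le
    have h3 := laplace_nonneg (ν := ν) (R := R) i l
    have h4 : 0 ≤ 1 ^ m * laplace ν R i 1 * Real.exp (m ^ 2 / (2 * R)) := by
      have := laplace_nonneg (ν := ν) (R := R) i 1; positivity
    nlinarith

theorem abs_laplaceDeriv_le [IsFiniteMeasure ν] (hν : IsSpherical ν R) (i : Fin n) {m l : ℝ}
    (hm : 0 ≤ m) (hl : 0 ≤ l) : |laplaceDeriv ν R i m l| ≤ (m + 1) * ν.real Set.univ := by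
  have := norm_integral_le_of_norm_le_const (μ := ν) (C := m + 1)
    (f := fun ω => (m - l * (R - ω i)) * Real.exp (-(l * (R - ω i)))) (by
      filter_upwards [hν.ae_sub_nonneg i] with ω hω
      have hx : 0 ≤ l * (R - ω i) := mul_nonneg hl hω
      set x := l * (R - ω i)
      have h1 : Real.exp (-x) ≤ 1 := Real.exp_le_one_iff.2 (by linarith)
      have h2 : x * Real.exp (-x) ≤ 1 := by
        rw [Real.exp_neg, ← div_eq_mul_inv, div_le_one (Real.exp_pos x)]
        linarith [Real.add_one_le_exp x]
      have h3 := (Real.exp_pos (-x)).le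
      rw [Real.norm_eq_abs, abs_le]
      constructor <;> nlinarith [mul_le_mul_of_nonneg_left h1 hm, mul_nonneg hm h3,
        mul_nonneg hx h3])
  simpa [laplaceDeriv] using this

theorem exists_abs_laplaceDeriv_le [IsFiniteMeasure ν] (hν : IsSpherical ν R) (hR : 0 < R)
    (hn : 1 ≤ n) (i : Fin n) : ∃ C, 0 ≤ C ∧ ∀ l, 0 < l →
      l ^ (((n : ℝ) - 1) / 2 + 1) * |laplaceDeriv ν R i (((n : ℝ) - 1) / 2) l| ≤ C := by
  obtain ⟨C, hC0, hC⟩ := hν.exists_laplace_le hR hn i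
  have hm2 : (n : ℝ) - 1 = 2 * (((n : ℝ) - 1) / 2) := by ring
  have hm0 : 0 ≤ ((n : ℝ) - 1) / 2 := by
    have : (1 : ℝ) ≤ n := by exact_mod_cast hn
    linarith
  have heq := hν.laplaceDeriv_eq hR i
  set m : ℝ := ((n : ℝ) - 1) / 2 with hm
  refine ⟨(4 * m + 8) / (2 * R) * (2 ^ m * C), by positivity, fun l hl => ?_⟩
  have key : |laplaceDeriv ν R i m l| ≤ (4 * m + 8) / (2 * R) / l * laplace ν R i (l / 2) := by
    rw [heq, hm2, laplace, ← integral_const_mul]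
    refine (abs_integral_le_integral_abs).trans ?_
    refine integral_mono_ae (hν.integrable_of_continuous (by fun_prop))
        (hν.integrable_of_continuous (by fun_prop)) ?_
    filter_upwards [hν.ae_sub_nonneg i] with ω hω
    set t := R - ω i
    have hx : 0 ≤ l * t / 2 := by positivity
    have hes : Real.exp (-(l * t)) = Real.exp (-(l / 2 * t)) * Real.exp (-(l * t / 2)) := by
      rw [← Real.exp_add]; congr 1; ring
    rw [abs_mul, abs_of_pos (Real.exp_pos _), hes, mul_comm (Real.exp (-(l / 2 * t))), ← mul_assoc]
    refine mul_le_mul_of_nonneg_right ?_ (Real.exp_pos _).le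
    rw [Real.exp_neg, ← div_eq_mul_inv, div_le_iff₀ (Real.exp_pos _)]
    have h1 := Real.quadratic_le_exp_of_nonneg hx
    rw [abs_div, abs_of_pos (by positivity : 0 < 2 * R), div_div, div_mul_eq_mul_div,
      div_le_div_iff₀ (by positivity) (by positivity)]
    have h2 : |2 * m * t - l * t ^ 2| * l ≤ (4 * m + 8) * Real.exp (l * t / 2) := by
      have h3 : |2 * m * t - l * t ^ 2| ≤ 2 * m * t + l * t ^ 2 := by
        rw [abs_le]
        have : 0 ≤ 2 * m * t := by positivity
        have : 0 ≤ l * t ^ 2 := by positivity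
        constructor <;> linarith
      have h4 := mul_le_mul_of_nonneg_right h3 hl.le
      refine h4.trans ?_
      have h5 : (4 * m + 8) * (1 + l * t / 2 + (l * t / 2) ^ 2 / 2) ≤
          (4 * m + 8) * Real.exp (l * t / 2) := by gcongr
      refine le_trans ?_ h5
      have : 0 ≤ m * (l * t / 2) ^ 2 := by positivity
      nlinarith
    nlinarith [mul_le_mul_of_nonneg_left h2 (by positivity : 0 ≤ 2 * R)]
  have h1 := hC (l / 2) (by positivity)
  have h2 : l ^ m * laplace ν R i (l / 2) ≤ 2 ^ m * C := by
    have : l ^ m = 2 ^ m * (l / 2) ^ m := by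
      rw [← Real.mul_rpow (by norm_num) (by positivity)]; congr 1; ring
    rw [this, mul_assoc]
    gcongr
  calc l ^ (m + 1) * |laplaceDeriv ν R i m l|
      ≤ l ^ (m + 1) * ((4 * m + 8) / (2 * R) / l * laplace ν R i (l / 2)) := by gcongr
    _ = (4 * m + 8) / (2 * R) * (l ^ m * laplace ν R i (l / 2)) := by
        rw [Real.rpow_add_one hl.ne']; field_simp
    _ ≤ _ := by gcongr

end IsSpherical

namespace IsSpherical

variable {n : ℕ} {ν : Measure (EuclideanSpace ℝ (Fin n))} {R : ℝ}

theorem integral_comp_inner (hν : IsSpherical ν R) (i : Fin n) {G : Type*} [NormedAddCommGroup G]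
    [NormedSpace ℝ G] (F : ℝ → G) (ξ : EuclideanSpace ℝ (Fin n)) :
    ∫ ω, F ⟪ω, ξ⟫ ∂ν = ∫ ω, F (‖ξ‖ * ω i) ∂ν := by
  set w : EuclideanSpace ℝ (Fin n) := EuclideanSpace.single i ‖ξ‖ with hw
  have hL : (ℝ ∙ (ξ - w))ᗮ.reflection ξ = w := Submodule.reflection_sub (by simp [hw])
  rw [← hν.integral_comp_isometry ((ℝ ∙ (ξ - w))ᗮ.reflection) fun ω => F (‖ξ‖ * ω i)]
  congr 1
  ext ω
  congr 1
  rw [← LinearIsometryEquiv.inner_map_map ((ℝ ∙ (ξ - w))ᗮ.reflection) ω ξ, hL, hw,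
    EuclideanSpace.inner_single_right]
  simp

theorem exists_zonal_cos_le [IsFiniteMeasure ν] (hν : IsSpherical ν R) (hR : 0 < R)
    (i : Fin n) (b : ℝ) : ∃ C, 0 ≤ C ∧ ∀ l, 1 ≤ l →
      (l ^ (((n : ℝ) - 1) / 2) * |∫ ω, Real.cos (l * ω i - b) ∂ν|) ≤ C := by
  set k : ℝ → ℝ := fun l => ∫ ω, Real.cos (l * ω i - b) ∂ν with hk
  set k' : ℝ → ℝ := fun l => ∫ ω, -Real.sin (l * ω i - b) * ω i ∂ν with hk'
  set k'' : ℝ → ℝ := fun l => ∫ ω, -(Real.cos (l * ω i - b) * ω i) * ω i ∂ν with hk''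
  have hin : ∀ (c x : ℝ), HasDerivAt (fun y : ℝ => y * c - b) c x := fun c x => by
    simpa using ((hasDerivAt_id x).mul_const c).sub_const b
  have hkd : ∀ x, HasDerivAt k (k' x) x :=
    hν.hasDerivAt_integral (F := fun l ω => Real.cos (l * ω i - b))
      (F' := fun l ω => -Real.sin (l * ω i - b) * ω i) (by intro x; fun_prop) (by fun_prop)
      fun x ω => (hin (ω i) x).cos
  have hkd' : ∀ x, HasDerivAt k' (k'' x) x :=
    hν.hasDerivAt_integral (F := fun l ω => -Real.sin (l * ω i - b) * ω i)
      (F' := fun l ω => -(Real.cos (l * ω i - b) * ω i) * ω i) (by intro x; fun_prop)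
      (by fun_prop) fun x ω => ((hin (ω i) x).sin.fun_neg).mul_const _
  set m : ℝ := ((n : ℝ) - 1) / 2 with hm
  have hode : ∀ x, 0 < x → k'' x = -(R ^ 2 * k x) - 2 * m / x * k' x := by
    intro x hx
    have h := hν.integral_by_parts i (φ := fun u => Real.sin (x * u - b))
      (φ' := fun u => Real.cos (x * u - b) * x)
      (by
        intro u
        have : HasDerivAt (fun u : ℝ => x * u - b) x u := by
          simpa using ((hasDerivAt_id u).const_mul x).sub_const b
        exact this.sin) (by fun_prop)
    have h2 : x * k'' x + x * (R ^ 2 * k x) + 2 * m * k' x =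
        -∫ ω, (((n : ℝ) - 1) * ω i * Real.sin (x * ω i - b) -
          (R ^ 2 - ω i ^ 2) * (Real.cos (x * ω i - b) * x)) ∂ν := by
      simp only [hk, hk', hk'']
      rw [← integral_const_mul, ← integral_const_mul, ← integral_const_mul, ← integral_const_mul,
        ← integral_add (hν.integrable_of_continuous (by fun_prop))
          (hν.integrable_of_continuous (by fun_prop)),
        ← integral_add (hν.integrable_of_continuous (by fun_prop))
          (hν.integrable_of_continuous (by fun_prop)), ← integral_neg]
      congr 1
      ext ω
      rw [hm]
      ring
    rw [h, neg_zero] at h2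
    field_simp
    linarith
  set E : ℝ → ℝ := fun x => x ^ (2 * m) * (R ^ 2 * k x ^ 2 + (k' x + m / x * k x) ^ 2) with hE
  have hEd : ∀ x, 0 < x → HasDerivAt E
      (x ^ (2 * m) * (2 * (m ^ 2 - m) / x ^ 2 * (k x * (k' x + m / x * k x)))) x := by
    intro x hx
    have hdiv : HasDerivAt (fun y : ℝ => m / y) (-(m / x ^ 2)) x := by
      refine ((hasDerivAt_inv hx.ne').const_mul m).congr_deriv ?_
      ring
    have h1 := ((hkd' x).add (hdiv.mul (hkd x))).pow 2
    have h2 := ((hkd x).pow 2).const_mul (R ^ 2)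
    refine ((hasDerivAt_rpow_div hx (2 * m)).mul (h2.add h1)).congr_deriv ?_
    simp only [Pi.add_apply, Pi.mul_apply, Pi.pow_apply, Nat.cast_ofNat, Nat.add_one_sub_one,
      pow_one]
    rw [hode x hx]
    field_simp
    ring
  have hE0 : ∀ x, 0 < x → 0 ≤ E x := fun x hx => by
    have := Real.rpow_nonneg hx.le (2 * m)
    positivity
  have hle : ∀ x, 0 < x →
      x ^ (2 * m) * (2 * (m ^ 2 - m) / x ^ 2 * (k x * (k' x + m / x * k x))) ≤
        (|m ^ 2 - m| / R) / x ^ 2 * E x := by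
    intro x hx
    set q := k' x + m / x * k x
    have h1 : 2 * (m ^ 2 - m) * (k x * q) ≤ |m ^ 2 - m| / R * (R ^ 2 * k x ^ 2 + q ^ 2) := by
      rw [div_mul_eq_mul_div, le_div_iff₀ hR]
      have h2 : 2 * (R * (k x * q)) ≤ R ^ 2 * k x ^ 2 + q ^ 2 := by
        nlinarith [sq_nonneg (R * k x - q)]
      have h3 : -(2 * (R * (k x * q))) ≤ R ^ 2 * k x ^ 2 + q ^ 2 := by
        nlinarith [sq_nonneg (R * k x + q)]
      rcases abs_cases (m ^ 2 - m) with ⟨h, h'⟩ | ⟨h, h'⟩ <;> rw [h]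
      · nlinarith [mul_le_mul_of_nonneg_left h2 h']
      · nlinarith [mul_le_mul_of_nonneg_left h3 (neg_nonneg.2 h'.le)]
    have h4 := mul_le_mul_of_nonneg_left h1
      (by have := Real.rpow_nonneg hx.le (2 * m); positivity : 0 ≤ x ^ (2 * m) / x ^ 2)
    calc _ = x ^ (2 * m) / x ^ 2 * (2 * (m ^ 2 - m) * (k x * q)) := by ring
      _ ≤ _ := h4
      _ = _ := by simp only [hE]; ring
  refine ⟨√(E 1 * Real.exp (|m ^ 2 - m| / R)) / R, by positivity, fun l hl => ?_⟩
  have hfin := le_of_mul_exp_deriv_nonpos (by positivity) hE0 hEd hle hl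
  have hl0 : 0 < l := one_pos.trans_le hl
  rw [le_div_iff₀ hR]
  refine Real.le_sqrt_of_sq_le (le_trans ?_ hfin)
  have : (l ^ m) ^ 2 = l ^ (2 * m) := by
    rw [← Real.rpow_natCast, ← Real.rpow_mul hl0.le, mul_comm]; norm_num
  rw [mul_pow, mul_pow, this, sq_abs]
  simp only [hE]
  have h0 := Real.rpow_nonneg hl0.le (2 * m)
  nlinarith [mul_nonneg h0 (sq_nonneg (k' l + m / l * k l))]

theorem norm_integral_exp_le [IsFiniteMeasure ν] (x : EuclideanSpace ℝ (Fin n)) :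
    ‖∫ ω, Complex.exp (Complex.I * (⟪ω, x⟫ : ℝ)) ∂ν‖ ≤ ν.real Set.univ := by
  have := norm_integral_le_of_norm_le_const (μ := ν) (C := 1)
    (f := fun ω => Complex.exp (Complex.I * (⟪ω, x⟫ : ℝ)))
    (Filter.Eventually.of_forall fun ω => by rw [mul_comm, Complex.norm_exp_ofReal_mul_I])
  simpa using this

theorem exists_norm_integral_exp_le [IsFiniteMeasure ν] (hν : IsSpherical ν R) (hR : 0 < R)
    (hn : 1 ≤ n) : ∃ C, 0 ≤ C ∧ ∀ x : EuclideanSpace ℝ (Fin n),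
      (1 + ‖x‖ ^ 2) ^ (((n : ℝ) - 1) / 4) *
        ‖∫ ω, Complex.exp (Complex.I * (⟪ω, x⟫ : ℝ)) ∂ν‖ ≤ C := by
  have i : Fin n := ⟨0, hn⟩
  obtain ⟨C₁, hC₁, h1⟩ := hν.exists_zonal_cos_le hR i 0
  obtain ⟨C₂, hC₂, h2⟩ := hν.exists_zonal_cos_le hR i (Real.pi / 2)
  have hm0 : 0 ≤ ((n : ℝ) - 1) / 4 := by
    have : (1 : ℝ) ≤ n := by exact_mod_cast hn
    linarith
  set m : ℝ := ((n : ℝ) - 1) / 4 with hm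
  have hm2 : ((n : ℝ) - 1) / 2 = 2 * m := by rw [hm]; ring
  rw [hm2] at h1 h2
  refine ⟨2 ^ m * (C₁ + C₂ + ν.real Set.univ), by positivity, fun x => ?_⟩
  have hν0 : 0 ≤ ν.real Set.univ := measureReal_nonneg
  rcases le_total 1 ‖x‖ with h | h
  · have hx0 : 0 ≤ ‖x‖ := norm_nonneg x
    have e1 : (1 + ‖x‖ ^ 2) ^ m ≤ 2 ^ m * ‖x‖ ^ (2 * m) := by
      rw [Real.rpow_mul hx0, ← Real.mul_rpow (by norm_num) (by positivity)]
      refine Real.rpow_le_rpow (by positivity) ?_ hm0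
      have : (1 : ℝ) ≤ ‖x‖ ^ 2 := one_le_pow₀ h
      rw [Real.rpow_two]; linarith
    have e2 : ‖∫ ω, Complex.exp (Complex.I * (⟪ω, x⟫ : ℝ)) ∂ν‖ ≤
        |∫ ω, Real.cos (‖x‖ * ω i - 0) ∂ν| + |∫ ω, Real.cos (‖x‖ * ω i - Real.pi / 2) ∂ν| := by
      rw [hν.integral_comp_inner i (fun t : ℝ => Complex.exp (Complex.I * (t : ℝ))) x]
      have hint : Integrable (fun ω => Complex.exp (Complex.I * ((‖x‖ * ω i : ℝ) : ℂ))) ν :=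
        hν.integrable_of_continuous (by fun_prop)
      refine (Complex.norm_le_abs_re_add_abs_im _).trans (le_of_eq ?_)
      have hre := Complex.reCLM.integral_comp_comm hint
      have him := Complex.imCLM.integral_comp_comm hint
      simp only [Complex.reCLM_apply, Complex.imCLM_apply] at hre him
      rw [← hre, ← him]
      congr 3
      · ext ω
        rw [mul_comm Complex.I, Complex.exp_ofReal_mul_I_re, sub_zero]
      · ext ω
        rw [mul_comm Complex.I, Complex.exp_ofReal_mul_I_im, Real.cos_sub_pi_div_two]
    have h1' := h1 _ h
    have h2' := h2 _ h
    calc _ ≤ 2 ^ m * ‖x‖ ^ (2 * m) * (|∫ ω, Real.cos (‖x‖ * ω i - 0) ∂ν| +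
          |∫ ω, Real.cos (‖x‖ * ω i - Real.pi / 2) ∂ν|) := by gcongr
      _ = 2 ^ m * (‖x‖ ^ (2 * m) * |∫ ω, Real.cos (‖x‖ * ω i - 0) ∂ν| + ‖x‖ ^ (2 * m) *
          |∫ ω, Real.cos (‖x‖ * ω i - Real.pi / 2) ∂ν|) := by ring
      _ ≤ _ := mul_le_mul_of_nonneg_left (by linarith) (by positivity)
  · have e1 : (1 + ‖x‖ ^ 2) ^ m ≤ 2 ^ m := by
      refine Real.rpow_le_rpow (by positivity) ?_ hm0
      have : ‖x‖ ^ 2 ≤ 1 := pow_le_one₀ (norm_nonneg x) h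
      linarith
    have e2 := norm_integral_exp_le (ν := ν) x
    gcongr
    linarith

end IsSpherical

theorem norm_integral_cpow_mul_le {H H' Φ Φ' : ℝ → ℝ} {C η a b : ℝ} (ha : 0 < a) (hab : a ≤ b)
    (hη : η ≠ 0) (hH : ∀ s, 0 < s → HasDerivAt H (H' s) s)
    (hΦ : ∀ s, 0 < s → HasDerivAt Φ (Φ' s) s) (hΦ' : ContinuousOn Φ' (Set.Ioi 0))
    (hle : ∀ s, 0 < s → |H' s| ≤ Φ' s) (hHC : ∀ s, 0 < s → |H s| ≤ C)
    (hΦC : ∀ s, 0 < s → |Φ s| ≤ C) :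
    ‖∫ s in a..b, (s : ℂ) ^ (Complex.I * η - 1) * (H s : ℂ)‖ ≤ 4 * C / |η| := by
  have hpos : ∀ s ∈ Set.uIcc a b, 0 < s := by
    intro s hs
    rw [Set.uIcc_of_le hab] at hs
    exact ha.trans_le hs.1
  have hsub : Set.uIcc a b ⊆ Set.Ioi 0 := hpos
  have hr : Complex.I * (η : ℂ) - 1 ≠ -1 := by
    intro h
    have : Complex.I * (η : ℂ) = 0 := by linear_combination h
    simp [hη] at this
  set v : ℝ → ℂ := fun s => (s : ℂ) ^ (Complex.I * η - 1 + 1) / (Complex.I * η - 1 + 1) with hv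
  have hvd : ∀ s : ℝ, 0 < s → HasDerivAt v ((s : ℂ) ^ (Complex.I * η - 1)) s :=
    fun s hs => hasDerivAt_ofReal_cpow_const' hs.ne' hr
  have hvn : ∀ s : ℝ, 0 < s → ‖v s‖ = 1 / |η| := by
    intro s hs
    simp only [hv, sub_add_cancel, norm_div, Complex.norm_cpow_eq_rpow_re_of_pos hs]
    simp
  have hΦint : IntervalIntegrable Φ' volume a b := (hΦ'.mono hsub).intervalIntegrable
  have hHint : IntervalIntegrable H' volume a b := by
    have h1 : IntervalIntegrable (deriv H) volume a b := by
      refine hΦint.mono_fun (measurable_deriv H).aestronglyMeasurable ?_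
      refine (ae_restrict_iff' measurableSet_uIoc).2 (Filter.Eventually.of_forall fun s hs => ?_)
      have hs0 := hpos s (Set.uIoc_subset_uIcc hs)
      simp only [(hH s hs0).deriv, Real.norm_eq_abs]
      exact (hle s hs0).trans (le_abs_self _)
    refine h1.congr ?_
    intro s hs
    exact (hH s (hpos s (Set.uIoc_subset_uIcc hs))).deriv
  have hvint : IntervalIntegrable (fun s : ℝ => (s : ℂ) ^ (Complex.I * η - 1)) volume a b := by
    refine ContinuousOn.intervalIntegrable fun s hs => ?_
    have h0 : (s : ℂ) ∈ Complex.slitPlane := Complex.ofReal_mem_slitPlane.2 (hpos s hs)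
    exact (Complex.continuous_ofReal.continuousAt.cpow continuousAt_const h0).continuousWithinAt
  have hHint' : IntervalIntegrable (fun s => (H' s : ℂ)) volume a b :=
    ⟨hHint.1.ofReal, hHint.2.ofReal⟩
  have key := intervalIntegral.integral_mul_deriv_eq_deriv_mul (a := a) (b := b)
    (u := fun s => (H s : ℂ)) (u' := fun s => (H' s : ℂ)) (v := v)
    (fun s hs => (hH s (hpos s hs)).ofReal_comp) (fun s hs => hvd s (hpos s hs)) hHint' hvint
  have hcomm : ∫ s in a..b, (s : ℂ) ^ (Complex.I * η - 1) * (H s : ℂ) =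
      ∫ s in a..b, (H s : ℂ) * (s : ℂ) ^ (Complex.I * η - 1) := by
    congr 1; ext s; ring
  rw [hcomm, key]
  have hb0 : 0 < b := ha.trans_le hab
  have hη0 : 0 < |η| := abs_pos.2 hη
  have e1 : ∀ s, 0 < s → ‖(H s : ℂ) * v s‖ ≤ C / |η| := by
    intro s hs
    rw [norm_mul, hvn s hs, Complex.norm_real, Real.norm_eq_abs, mul_one_div]
    exact div_le_div_of_nonneg_right (hHC s hs) hη0.le
  have e2 : ‖∫ s in a..b, (H' s : ℂ) * v s‖ ≤ 2 * C / |η| := by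
    have h1 : ‖∫ s in a..b, (H' s : ℂ) * v s‖ ≤ ∫ s in a..b, Φ' s * (1 / |η|) := by
      refine intervalIntegral.norm_integral_le_of_norm_le hab ?_ (hΦint.mul_const _)
      refine Filter.Eventually.of_forall fun s hs => ?_
      have hs0 : 0 < s := ha.trans hs.1
      rw [norm_mul, hvn s hs0, Complex.norm_real, Real.norm_eq_abs]
      exact mul_le_mul_of_nonneg_right (hle s hs0) (by positivity)
    refine h1.trans ?_
    rw [intervalIntegral.integral_mul_const, mul_one_div,
      intervalIntegral.integral_eq_sub_of_hasDerivAt (fun s hs => hΦ s (hpos s hs)) hΦint]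
    refine div_le_div_of_nonneg_right ?_ hη0.le
    have h2 := abs_le.1 (hΦC b hb0)
    have h3 := abs_le.1 (hΦC a ha)
    linarith [h2.2, h3.1]
  calc _ ≤ ‖(H b : ℂ) * v b‖ + ‖(H a : ℂ) * v a‖ + ‖∫ s in a..b, (H' s : ℂ) * v s‖ :=
        (norm_sub_le _ _).trans (add_le_add_left (norm_sub_le _ _) _)
    _ ≤ C / |η| + C / |η| + 2 * C / |η| := add_le_add (add_le_add (e1 b hb0) (e1 a ha)) e2
    _ = _ := by ring

theorem exists_rpow_neg_mul_exp_le {k c : ℝ} (hk : 0 ≤ k) (hc : 0 < c) :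
    ∃ C, 0 ≤ C ∧ ∀ s, 0 < s → s ^ (-k) * Real.exp (-(c / s)) ≤ C := by
  obtain ⟨N, hN⟩ := exists_nat_ge k
  refine ⟨1 + N.factorial / c ^ N, by positivity, fun s hs => ?_⟩
  have hu : 0 < s⁻¹ := inv_pos.2 hs
  have h1 : s ^ (-k) ≤ 1 + s⁻¹ ^ N := by
    rw [Real.rpow_neg hs.le, ← Real.inv_rpow hs.le]
    rcases le_total s⁻¹ 1 with h | h
    · have := Real.rpow_le_one hu.le h hk
      have := pow_nonneg hu.le N
      linarith
    · have := Real.rpow_le_rpow_of_exponent_le h hN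
      rw [Real.rpow_natCast] at this
      linarith
  have h2 := Real.pow_div_factorial_le_exp (c * s⁻¹) (by positivity) N
  have h3 : Real.exp (-(c / s)) ≤ 1 := Real.exp_le_one_iff.2 (by
    have : 0 < c / s := by positivity
    linarith)
  have h4 : s⁻¹ ^ N * Real.exp (-(c / s)) ≤ N.factorial / c ^ N := by
    rw [Real.exp_neg, ← div_eq_mul_inv, div_le_div_iff₀ (Real.exp_pos _) (by positivity)]
    rw [div_le_iff₀ (by positivity), mul_pow] at h2
    rw [div_eq_mul_inv]
    linarith
  calc _ ≤ (1 + s⁻¹ ^ N) * Real.exp (-(c / s)) := by gcongr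
    _ = Real.exp (-(c / s)) + s⁻¹ ^ N * Real.exp (-(c / s)) := by ring
    _ ≤ _ := add_le_add h3 h4

namespace IsSpherical

variable {n : ℕ} {ν : Measure (EuclideanSpace ℝ (Fin n))} {R : ℝ}

theorem integral_exp_norm_sub (hν : IsSpherical ν R) (i : Fin n) (ξ : EuclideanSpace ℝ (Fin n))
    {s : ℝ} (hs : 0 < s) : ∫ ω, Real.exp (-(‖ξ - ω‖ ^ 2 / (4 * s))) ∂ν =
      Real.exp (-((‖ξ‖ - R) ^ 2 / 4 / s)) * laplace ν R i (‖ξ‖ / 2 / s) := by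
  have h1 : ∫ ω, Real.exp (-(‖ξ - ω‖ ^ 2 / (4 * s))) ∂ν =
      ∫ ω, (fun t : ℝ => Real.exp (-((‖ξ‖ ^ 2 - 2 * t + R ^ 2) / (4 * s)))) ⟪ω, ξ⟫ ∂ν := by
    refine integral_congr_ae ?_
    filter_upwards [hν.norm_eq] with ω hω
    rw [@norm_sub_sq_real, hω, real_inner_comm]
  rw [h1, hν.integral_comp_inner i
    (fun t : ℝ => Real.exp (-((‖ξ‖ ^ 2 - 2 * t + R ^ 2) / (4 * s)))) ξ, laplace,
    ← integral_const_mul]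
  congr 1
  ext ω
  rw [← Real.exp_add]
  congr 1
  field_simp
  ring

/-- The radial profile of a Gaussian mollification of `ν`, damped at infinity. -/
def profile (ν : Measure (EuclideanSpace ℝ (Fin n))) (R : ℝ) (i : Fin n) (ρ s : ℝ) : ℝ :=
  Real.exp (-s) * s ^ (-(((n : ℝ) - 1) / 2)) *
    (Real.exp (-((ρ - R) ^ 2 / 4 / s)) * laplace ν R i (ρ / 2 / s))

theorem hasDerivAt_profile [IsFiniteMeasure ν] (hν : IsSpherical ν R) (i : Fin n) {ρ s : ℝ}
    (hρ : 0 < ρ) (hs : 0 < s) : HasDerivAt (profile ν R i ρ)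
      (Real.exp (-s) * s ^ (-(((n : ℝ) - 1) / 2)) * Real.exp (-((ρ - R) ^ 2 / 4 / s)) *
        ((-1 + (ρ - R) ^ 2 / 4 / s ^ 2) * laplace ν R i (ρ / 2 / s) -
          laplaceDeriv ν R i (((n : ℝ) - 1) / 2) (ρ / 2 / s) / s)) s := by
  set m : ℝ := ((n : ℝ) - 1) / 2 with hm
  have h1 : HasDerivAt (fun s : ℝ => Real.exp (-s)) (-Real.exp (-s)) s := by
    simpa using (hasDerivAt_neg s).exp
  have h2 := hasDerivAt_rpow_div hs (-m)
  have h3 : HasDerivAt (fun s : ℝ => Real.exp (-((ρ - R) ^ 2 / 4 / s)))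
      (Real.exp (-((ρ - R) ^ 2 / 4 / s)) * ((ρ - R) ^ 2 / 4 / s ^ 2)) s := by
    have := hasDerivAt_exp_div hs (-((ρ - R) ^ 2 / 4))
    simpa [neg_div] using this
  have h4 : HasDerivAt (fun s : ℝ => ρ / 2 / s) (-(ρ / 2 / s ^ 2)) s := by
    refine ((hasDerivAt_inv hs.ne').const_mul (ρ / 2)).congr_deriv ?_
    ring
  have h5 := (hν.hasDerivAt_laplace i m (l := ρ / 2 / s) (by positivity)).comp s h4
  refine ((h1.mul h2).mul (h3.mul h5)).congr_deriv ?_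
  simp only [Pi.mul_apply, Function.comp_apply]
  field_simp
  ring

set_option maxHeartbeats 1000000 in
theorem exists_profile_bounds [IsFiniteMeasure ν] (hν : IsSpherical ν R) (hR : 0 < R)
    (hn : 1 ≤ n) (i : Fin n) : ∃ C, 0 ≤ C ∧ ∀ ρ s, 0 < ρ → 0 < s →
      |profile ν R i ρ s| ≤ C ∧
      |Real.exp (-s) * s ^ (-(((n : ℝ) - 1) / 2)) * Real.exp (-((ρ - R) ^ 2 / 4 / s)) *
        ((-1 + (ρ - R) ^ 2 / 4 / s ^ 2) * laplace ν R i (ρ / 2 / s) -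
          laplaceDeriv ν R i (((n : ℝ) - 1) / 2) (ρ / 2 / s) / s)| ≤
        C * (Real.exp (-s) + Real.exp (-((ρ - R) ^ 2 / 4 / s)) * ((ρ - R) ^ 2 / 4 / s ^ 2)) := by
  obtain ⟨CB, hCB0, hCB⟩ := hν.exists_laplace_le hR hn i
  obtain ⟨CN, hCN0, hCN⟩ := hν.exists_abs_laplaceDeriv_le hR hn i
  have hm0 : 0 ≤ ((n : ℝ) - 1) / 2 := by
    have : (1 : ℝ) ≤ n := by exact_mod_cast hn
    linarith
  have hNb : ∀ l : ℝ, 0 ≤ l → |laplaceDeriv ν R i (((n : ℝ) - 1) / 2) l| ≤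
      (((n : ℝ) - 1) / 2 + 1) * ν.real Set.univ := fun l hl => hν.abs_laplaceDeriv_le i hm0 hl
  unfold profile
  set m : ℝ := ((n : ℝ) - 1) / 2 with hm
  have hc0 : 0 < R ^ 2 / 16 := by positivity
  obtain ⟨D₀, hD₀, hD₀'⟩ := exists_rpow_neg_mul_exp_le hm0 hc0
  obtain ⟨D₁, hD₁, hD₁'⟩ := exists_rpow_neg_mul_exp_le (by linarith : 0 ≤ m + 1) hc0
  obtain ⟨D₂, hD₂, hD₂'⟩ := exists_rpow_neg_mul_exp_le (by linarith : 0 ≤ m + 2) hc0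
  set V := ν.real Set.univ with hV
  have hV0 : 0 ≤ V := measureReal_nonneg
  set K₁ := CB * (R / 4) ^ (-m) + CN * (R / 4) ^ (-(m + 1)) with hK₁
  set K₂ := D₀ * V + R ^ 2 / 4 * (D₂ * V) + D₁ * ((m + 1) * V) with hK₂
  have hK₁0 : 0 ≤ K₁ := by positivity
  have hK₂0 : 0 ≤ K₂ := by positivity
  refine ⟨K₁ + K₂, by positivity, fun ρ s hρ hs => ?_⟩
  have hl : 0 < ρ / 2 / s := by positivity
  have hB0 := laplace_nonneg (ν := ν) (R := R) i (ρ / 2 / s)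
  have hBV := hν.laplace_le_measure i hl.le
  have hNV := hNb _ hl.le
  have hCBl := hCB _ hl
  have hCNl := hCN _ hl
  set B := laplace ν R i (ρ / 2 / s)
  set N := laplaceDeriv ν R i m (ρ / 2 / s)
  have hes : Real.exp (-s) ≤ 1 := Real.exp_le_one_iff.2 (by linarith)
  have hes0 := Real.exp_pos (-s)
  have ha0 : 0 ≤ (ρ - R) ^ 2 / 4 := by positivity
  set a := (ρ - R) ^ 2 / 4 with ha
  set G := Real.exp (-(a / s)) with hG
  have hG0 : 0 < G := Real.exp_pos _
  have hG1 : G ≤ 1 := Real.exp_le_one_iff.2 (by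
    have : 0 ≤ a / s := by positivity
    linarith)
  have hsm : 0 < s ^ (-m) := Real.rpow_pos_of_pos hs _
  have hN0 := abs_nonneg N
  have hsplit : |Real.exp (-s) * s ^ (-m) * G * ((-1 + a / s ^ 2) * B - N / s)| ≤
      Real.exp (-s) * (G * (s ^ (-m) * B)) + Real.exp (-s) * (G * (s ^ (-m) * B) * (a / s ^ 2)) +
        Real.exp (-s) * (G * (s ^ (-m) * |N| / s)) := by
    have h1 : |(-1 + a / s ^ 2) * B - N / s| ≤ B + a / s ^ 2 * B + |N| / s := by
      have h2 : |N / s| = |N| / s := by rw [abs_div, abs_of_pos hs]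
      have h3 : |(-1 + a / s ^ 2) * B| ≤ B + a / s ^ 2 * B := by
        have : 0 ≤ a / s ^ 2 * B := by positivity
        rw [abs_le]; constructor <;> nlinarith
      calc _ ≤ |(-1 + a / s ^ 2) * B| + |N / s| := abs_sub _ _
        _ ≤ _ := by rw [h2]; linarith
    rw [abs_mul, abs_of_pos (by positivity : 0 < Real.exp (-s) * s ^ (-m) * G)]
    refine (mul_le_mul_of_nonneg_left h1 (by positivity)).trans (le_of_eq ?_)
    ring
  have habs : |Real.exp (-s) * s ^ (-m) * (G * B)| = Real.exp (-s) * (G * (s ^ (-m) * B)) := by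
    rw [abs_of_nonneg (by positivity)]; ring
  rw [habs]
  rcases le_total (R / 2) ρ with h | h
  · have hρ4 : R / 4 ≤ ρ / 2 := by linarith
    have hR4 : 0 < R / 4 := by positivity
    have e1 : s ^ (-m) * B ≤ CB * (R / 4) ^ (-m) := by
      have h2 : s ^ (-m) = (ρ / 2 / s) ^ m * (ρ / 2) ^ (-m) := by
        rw [Real.div_rpow (by positivity) hs.le, Real.rpow_neg hs.le, Real.rpow_neg (by positivity)]
        have := (Real.rpow_pos_of_pos (by positivity : 0 < ρ / 2) m).ne'
        field_simp
      have h3 : (ρ / 2) ^ (-m) ≤ (R / 4) ^ (-m) :=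
        Real.rpow_le_rpow_of_nonpos hR4 hρ4 (by linarith)
      rw [h2, mul_right_comm]
      gcongr
    have e2 : s ^ (-m) * |N| / s ≤ CN * (R / 4) ^ (-(m + 1)) := by
      have h2 : s ^ (-m) / s = (ρ / 2 / s) ^ (m + 1) * (ρ / 2) ^ (-(m + 1)) := by
        rw [Real.div_rpow (by positivity) hs.le, Real.rpow_neg hs.le,
          Real.rpow_neg (by positivity), Real.rpow_add_one hs.ne']
        have := (Real.rpow_pos_of_pos (by positivity : 0 < ρ / 2) (m + 1)).ne'
        field_simp
      have h3 : (ρ / 2) ^ (-(m + 1)) ≤ (R / 4) ^ (-(m + 1)) :=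
        Real.rpow_le_rpow_of_nonpos hR4 hρ4 (by linarith)
      rw [mul_div_right_comm, h2, mul_right_comm]
      gcongr
    have hP1 : 0 ≤ CB * (R / 4) ^ (-m) := by positivity
    have hP2 : 0 ≤ CN * (R / 4) ^ (-(m + 1)) := by positivity
    have f1 : G * (s ^ (-m) * B) ≤ CB * (R / 4) ^ (-m) :=
      (mul_le_of_le_one_left (by positivity) hG1).trans e1
    have f2 : G * (s ^ (-m) * |N| / s) ≤ CN * (R / 4) ^ (-(m + 1)) :=
      (mul_le_of_le_one_left (by positivity) hG1).trans e2
    constructor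
    · calc _ ≤ 1 * (CB * (R / 4) ^ (-m)) := by gcongr
        _ ≤ _ := by linarith
    · refine hsplit.trans ?_
      have f3 : Real.exp (-s) * (G * (s ^ (-m) * B) * (a / s ^ 2)) ≤
          (K₁ + K₂) * (G * (a / s ^ 2)) := by
        calc _ ≤ 1 * (G * (s ^ (-m) * B) * (a / s ^ 2)) := by gcongr
          _ = (s ^ (-m) * B) * (G * (a / s ^ 2)) := by ring
          _ ≤ _ := by gcongr; linarith
      have f4 : Real.exp (-s) * (G * (s ^ (-m) * B)) + Real.exp (-s) * (G * (s ^ (-m) * |N| / s)) ≤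
          (K₁ + K₂) * Real.exp (-s) := by
        rw [← mul_add, mul_comm]
        exact mul_le_mul_of_nonneg_right (by linarith) hes0.le
      linarith
  · have hac : R ^ 2 / 16 ≤ a := by rw [ha]; nlinarith
    have haR : a ≤ R ^ 2 / 4 := by rw [ha]; nlinarith
    have hGc : G ≤ Real.exp (-(R ^ 2 / 16 / s)) := by
      rw [hG]; gcongr
    have hd0 : G * s ^ (-m) ≤ D₀ :=
      le_trans (by rw [mul_comm]; gcongr) (hD₀' s hs)
    have hd1 : G * (s ^ (-m) / s) ≤ D₁ := by
      refine le_trans ?_ (hD₁' s hs)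
      rw [mul_comm, neg_add', Real.rpow_sub_one hs.ne']
      gcongr
    have hd2 : G * (s ^ (-m) / s ^ 2) ≤ D₂ := by
      refine le_trans ?_ (hD₂' s hs)
      rw [mul_comm, neg_add', Real.rpow_sub hs, Real.rpow_two]
      gcongr
    have f1 : G * (s ^ (-m) * B) ≤ D₀ * V := by
      rw [← mul_assoc]; gcongr
    have f2 : G * (s ^ (-m) * B) * (a / s ^ 2) ≤ R ^ 2 / 4 * (D₂ * V) := by
      calc _ = a * (G * (s ^ (-m) / s ^ 2) * B) := by ring
        _ ≤ _ := by gcongr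
    have f3 : G * (s ^ (-m) * |N| / s) ≤ D₁ * ((m + 1) * V) := by
      calc _ = G * (s ^ (-m) / s) * |N| := by ring
        _ ≤ _ := by gcongr
    have g1 : 0 ≤ D₀ * V := by positivity
    have g2 : 0 ≤ R ^ 2 / 4 * (D₂ * V) := by positivity
    have g3 : 0 ≤ D₁ * ((m + 1) * V) := by positivity
    constructor
    · calc _ ≤ 1 * (D₀ * V) := by gcongr
        _ ≤ _ := by linarith
    · refine hsplit.trans ?_
      have f4 : 0 ≤ (K₁ + K₂) * (G * (a / s ^ 2)) := by positivity
      rw [← mul_add, ← mul_add, mul_add (K₁ + K₂), mul_comm (Real.exp (-s))]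
      have : (G * (s ^ (-m) * B) + G * (s ^ (-m) * B) * (a / s ^ 2) + G * (s ^ (-m) * |N| / s)) *
          Real.exp (-s) ≤ (K₁ + K₂) * Real.exp (-s) :=
        mul_le_mul_of_nonneg_right (by linarith) hes0.le
      linarith

theorem exists_norm_integral_profile_le [IsFiniteMeasure ν] (hν : IsSpherical ν R) (hR : 0 < R)
    (hn : 1 ≤ n) (i : Fin n) : ∃ C, 0 ≤ C ∧ ∀ ρ η a b : ℝ, 0 < ρ → η ≠ 0 → 0 < a → a ≤ b →
      ‖∫ s in a..b, (s : ℂ) ^ (Complex.I * η - 1) * (profile ν R i ρ s : ℂ)‖ ≤ C / |η| := by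
  obtain ⟨C, hC0, hC⟩ := hν.exists_profile_bounds hR hn i
  refine ⟨4 * C, by positivity, fun ρ η a b hρ hη ha hab => ?_⟩
  set A := (ρ - R) ^ 2 / 4
  refine norm_integral_cpow_mul_le (Φ := fun s => C * (-Real.exp (-s) + Real.exp (-(A / s))))
    (Φ' := fun s => C * (Real.exp (-s) + Real.exp (-(A / s)) * (A / s ^ 2)))
    ha hab hη (fun s hs => hν.hasDerivAt_profile i hρ hs) ?_ ?_ (fun s hs => (hC ρ s hρ hs).2)
    (fun s hs => (hC ρ s hρ hs).1) ?_
  · intro s hs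
    have h1 : HasDerivAt (fun s : ℝ => -Real.exp (-s)) (Real.exp (-s)) s := by
      simpa using (hasDerivAt_neg s).exp.fun_neg
    have h3 : HasDerivAt (fun s : ℝ => Real.exp (-(A / s)))
        (Real.exp (-(A / s)) * (A / s ^ 2)) s := by
      have := hasDerivAt_exp_div hs (-A)
      simpa [neg_div] using this
    exact (h1.add h3).const_mul C
  · intro s hs
    have hs0 : s ≠ 0 := (Set.mem_Ioi.1 hs).ne'
    have : ContinuousAt (fun s => C * (Real.exp (-s) + Real.exp (-(A / s)) * (A / s ^ 2))) s := by
      fun_prop (disch := simp [hs0])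
    exact this.continuousWithinAt
  · intro s hs
    have h1 : Real.exp (-s) ≤ 1 := Real.exp_le_one_iff.2 (by linarith)
    have h2 : Real.exp (-(A / s)) ≤ 1 := Real.exp_le_one_iff.2 (by
      have : 0 ≤ A / s := by positivity
      linarith)
    have h3 := Real.exp_pos (-s)
    have h4 := Real.exp_pos (-(A / s))
    rw [abs_mul, abs_of_nonneg hC0]
    refine mul_le_of_le_one_right hC0 (abs_le.2 ⟨?_, ?_⟩) <;> linarith

end IsSpherical

section BilinearForm

variable {n : ℕ}

/-- The bilinear form with convolution kernel `k`. -/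
def convForm (k f g : EuclideanSpace ℝ (Fin n) → ℂ) : ℂ :=
  ∫ p : EuclideanSpace ℝ (Fin n) × EuclideanSpace ℝ (Fin n), k (p.1 - p.2) * f p.2 * g p.1

/-- The Fourier integral with kernel `exp (i ⟨ξ, x⟩)`. -/
def fourierExp (f : EuclideanSpace ℝ (Fin n) → ℂ) (ξ : EuclideanSpace ℝ (Fin n)) : ℂ :=
  ∫ x, Complex.exp (Complex.I * (⟪ξ, x⟫ : ℝ)) * f x

theorem norm_exp_I_mul_ofReal (t : ℝ) : ‖Complex.exp (Complex.I * (t : ℂ))‖ = 1 := by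
  rw [mul_comm, Complex.norm_exp_ofReal_mul_I]

theorem continuous_fourierExp {f : EuclideanSpace ℝ (Fin n) → ℂ} (hf : Integrable f) :
    Continuous (fourierExp f) := by
  refine continuous_of_dominated (bound := fun x => ‖f x‖) ?_ ?_ hf.norm ?_
  · intro ξ
    exact (Continuous.aestronglyMeasurable (by fun_prop)).mul hf.1
  · intro ξ
    refine Filter.Eventually.of_forall fun x => ?_
    rw [norm_mul, norm_exp_I_mul_ofReal, one_mul]
  · refine Filter.Eventually.of_forall fun x => ?_
    fun_prop

theorem norm_fourierExp_le {f : EuclideanSpace ℝ (Fin n) → ℂ} (ξ : EuclideanSpace ℝ (Fin n)) :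
    ‖fourierExp f ξ‖ ≤ ∫ x, ‖f x‖ := by
  refine (norm_integral_le_integral_norm _).trans (le_of_eq ?_)
  congr 1; ext x
  rw [norm_mul, norm_exp_I_mul_ofReal, one_mul]

theorem fourierExp_conj (f : EuclideanSpace ℝ (Fin n) → ℂ) (ξ : EuclideanSpace ℝ (Fin n)) :
    fourierExp (fun x => starRingEnd ℂ (f x)) ξ = starRingEnd ℂ (fourierExp f (-ξ)) := by
  rw [fourierExp, fourierExp, ← integral_conj]
  congr 1; ext x
  simp [← Complex.exp_conj]

theorem convForm_fourierExp {M f g : EuclideanSpace ℝ (Fin n) → ℂ} (hM : Integrable M)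
    (hf : Integrable f) (hg : Integrable g) :
    convForm (fourierExp M) f g = ∫ ξ, M ξ * fourierExp f (-ξ) * fourierExp g ξ := by
  have hint : Integrable (fun q : (EuclideanSpace ℝ (Fin n) × EuclideanSpace ℝ (Fin n)) ×
      EuclideanSpace ℝ (Fin n) => Complex.exp (Complex.I * (⟪q.2, q.1.1 - q.1.2⟫ : ℝ)) *
        (g q.1.1 * f q.1.2 * M q.2)) := by
    refine ((hg.mul_prod hf).mul_prod hM).bdd_mul (c := 1)
      (Continuous.aestronglyMeasurable (by fun_prop)) (Filter.Eventually.of_forall fun q => ?_)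
    rw [norm_exp_I_mul_ofReal]
  calc convForm (fourierExp M) f g
      = ∫ p : EuclideanSpace ℝ (Fin n) × EuclideanSpace ℝ (Fin n), ∫ ξ,
          Complex.exp (Complex.I * (⟪ξ, p.1 - p.2⟫ : ℝ)) * (g p.1 * f p.2 * M ξ) := by
        rw [convForm]
        congr 1; ext p
        rw [fourierExp, mul_assoc, ← integral_mul_const]
        congr 1; ext ξ
        rw [real_inner_comm]
        ring
    _ = ∫ ξ, ∫ p : EuclideanSpace ℝ (Fin n) × EuclideanSpace ℝ (Fin n),
          Complex.exp (Complex.I * (⟪ξ, p.1 - p.2⟫ : ℝ)) * (g p.1 * f p.2 * M ξ) :=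
        integral_integral_swap hint
    _ = _ := by
        congr 1; ext ξ
        have : ∀ p : EuclideanSpace ℝ (Fin n) × EuclideanSpace ℝ (Fin n),
            Complex.exp (Complex.I * (⟪ξ, p.1 - p.2⟫ : ℝ)) * (g p.1 * f p.2 * M ξ) =
            M ξ * ((Complex.exp (Complex.I * (⟪ξ, p.1⟫ : ℝ)) * g p.1) *
              (Complex.exp (Complex.I * (⟪-ξ, p.2⟫ : ℝ)) * f p.2)) := by
          intro p
          rw [inner_sub_right, inner_neg_left, Complex.ofReal_sub, mul_sub, sub_eq_add_neg,
            Complex.exp_add, Complex.ofReal_neg, mul_neg]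
          ring
        simp_rw [this]
        rw [integral_const_mul, Measure.volume_eq_prod,
          integral_prod_mul (fun x => Complex.exp (Complex.I * (⟪ξ, x⟫ : ℝ)) * g x)
            (fun y => Complex.exp (Complex.I * (⟪-ξ, y⟫ : ℝ)) * f y)]
        rw [fourierExp, fourierExp]
        ring

theorem integrable_comp_sub_mul {k h : EuclideanSpace ℝ (Fin n) → ℝ} (hk : Integrable k)
    (hh : Integrable h) :
    Integrable (fun p : EuclideanSpace ℝ (Fin n) × EuclideanSpace ℝ (Fin n) =>
      k (p.1 - p.2) * h p.2) ∧
    ∫ p : EuclideanSpace ℝ (Fin n) × EuclideanSpace ℝ (Fin n), k (p.1 - p.2) * h p.2 =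
      (∫ x, k x) * ∫ x, h x := by
  have mp := measurePreserving_sub_prod (volume : Measure (EuclideanSpace ℝ (Fin n)))
    (volume : Measure (EuclideanSpace ℝ (Fin n)))
  have hi := hk.mul_prod hh
  refine ⟨mp.integrable_comp_of_integrable hi, ?_⟩
  rw [← integral_prod_mul]
  conv_rhs => rw [← mp.map_eq]
  rw [integral_map mp.aemeasurable (by rw [mp.map_eq]; exact hi.1)]
  rfl

theorem norm_convForm_le_integral {k : EuclideanSpace ℝ (Fin n) → ℂ}
    {f g : EuclideanSpace ℝ (Fin n) → ℂ} (hk : Integrable k) (hke : ∀ x, k (-x) = k x)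
    (hf : Integrable (fun x => ‖f x‖ ^ 2)) (hg : Integrable (fun x => ‖g x‖ ^ 2)) :
    ‖convForm k f g‖ ≤ (∫ x, ‖k x‖) * (((∫ x, ‖f x‖ ^ 2) + ∫ x, ‖g x‖ ^ 2) / 2) := by
  obtain ⟨h1, h2⟩ := integrable_comp_sub_mul hk.norm hf
  obtain ⟨h3, h4⟩ := integrable_comp_sub_mul hk.norm hg
  have h5 : Integrable (fun p : EuclideanSpace ℝ (Fin n) × EuclideanSpace ℝ (Fin n) =>
      ‖k (p.2 - p.1)‖ * ‖g p.1‖ ^ 2) := h3.swap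
  have h6 := integral_prod_swap (μ := (volume : Measure (EuclideanSpace ℝ (Fin n))))
    (ν := (volume : Measure (EuclideanSpace ℝ (Fin n))))
    (fun p : EuclideanSpace ℝ (Fin n) × EuclideanSpace ℝ (Fin n) => ‖k (p.1 - p.2)‖ * ‖g p.2‖ ^ 2)
  have hb : ‖convForm k f g‖ ≤ ∫ p : EuclideanSpace ℝ (Fin n) × EuclideanSpace ℝ (Fin n),
      ((‖k (p.1 - p.2)‖ * ‖f p.2‖ ^ 2) + ‖k (p.2 - p.1)‖ * ‖g p.1‖ ^ 2) / 2 := by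
    refine norm_integral_le_of_norm_le ((h1.add h5).div_const 2)
      (Filter.Eventually.of_forall fun p => ?_)
    have : k (p.2 - p.1) = k (p.1 - p.2) := by rw [← neg_sub, hke]
    rw [norm_mul, norm_mul, this]
    have := mul_nonneg (norm_nonneg (k (p.1 - p.2))) (sq_nonneg (‖f p.2‖ - ‖g p.1‖))
    linarith
  refine hb.trans (le_of_eq ?_)
  rw [integral_div, integral_add h1 h5]
  simp only [Prod.fst_swap, Prod.snd_swap] at h6
  rw [← Measure.volume_eq_prod] at h6
  rw [h2, h6, h4]
  ring

theorem fourierExp_gaussian {ε : ℝ} (hε : 0 < ε) (x : EuclideanSpace ℝ (Fin n)) :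
    fourierExp (fun ξ => (Real.exp (-ε * ‖ξ‖ ^ 2) : ℂ)) x =
      ((Real.pi / ε) ^ ((n : ℝ) / 2) * Real.exp (-(1 / (4 * ε)) * ‖x‖ ^ 2) : ℝ) := by
  have := GaussianFourier.integral_cexp_neg_mul_sq_norm_add (b := (ε : ℂ)) (by simpa using hε)
    Complex.I x
  have h2 : fourierExp (fun ξ => (Real.exp (-ε * ‖ξ‖ ^ 2) : ℂ)) x =
      ∫ v, Complex.exp (-(ε : ℂ) * ‖v‖ ^ 2 + Complex.I * (⟪x, v⟫ : ℝ)) := by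
    rw [fourierExp]
    congr 1; ext v
    rw [Complex.exp_add]
    push_cast
    ring
  rw [h2, this, Complex.ofReal_mul, Complex.ofReal_cpow (by positivity), finrank_euclideanSpace,
    Fintype.card_fin, Complex.ofReal_exp]
  congr 1
  · push_cast; rfl
  · congr 1
    rw [Complex.I_sq]
    push_cast
    field_simp

theorem integrable_gaussian {ε : ℝ} (hε : 0 < ε) :
    Integrable (fun ξ : EuclideanSpace ℝ (Fin n) => Real.exp (-ε * ‖ξ‖ ^ 2)) := by
  have := (GaussianFourier.integrable_cexp_neg_mul_sq_norm_add (b := (ε : ℂ)) (by simpa using hε)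
    0 (0 : EuclideanSpace ℝ (Fin n))).norm
  refine this.congr (Filter.Eventually.of_forall fun x => ?_)
  simp only [Complex.norm_exp]
  congr 1
  simp [← Complex.ofReal_pow, ← Complex.ofReal_mul, ← Complex.ofReal_neg]

theorem integral_gaussian_mul_norm_fourierExp_sq_le {f : EuclideanSpace ℝ (Fin n) → ℂ}
    (hf : Integrable f) (hf2 : Integrable (fun x => ‖f x‖ ^ 2)) {ε : ℝ} (hε : 0 < ε) :
    Integrable (fun ξ => Real.exp (-ε * ‖ξ‖ ^ 2) * ‖fourierExp f ξ‖ ^ 2) ∧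
    ∫ ξ, Real.exp (-ε * ‖ξ‖ ^ 2) * ‖fourierExp f ξ‖ ^ 2 ≤
      (2 * Real.pi) ^ n * ∫ x, ‖f x‖ ^ 2 := by
  have hG := integrable_gaussian (n := n) hε
  have hGc : Integrable (fun ξ : EuclideanSpace ℝ (Fin n) =>
      ((Real.exp (-ε * ‖ξ‖ ^ 2) : ℝ) : ℂ)) := hG.ofReal
  constructor
  · refine hG.mul_bdd (c := (∫ x, ‖f x‖) ^ 2)
      ((continuous_fourierExp hf).norm.pow 2).aestronglyMeasurable
      (Filter.Eventually.of_forall fun ξ => ?_)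
    rw [Real.norm_of_nonneg (by positivity)]
    gcongr
    exact norm_fourierExp_le ξ
  have hcf : Integrable (fun x => starRingEnd ℂ (f x)) := by
    simpa using (Complex.conjLIE.toContinuousLinearEquiv.toContinuousLinearMap).integrable_comp hf
  have hk : ∀ x : EuclideanSpace ℝ (Fin n), fourierExp (fun ξ => (Real.exp (-ε * ‖ξ‖ ^ 2) : ℂ)) x =
      ((Real.pi / ε) ^ ((n : ℝ) / 2) * Real.exp (-(1 / (4 * ε)) * ‖x‖ ^ 2) : ℝ) :=
    fourierExp_gaussian hε
  set k := fourierExp (fun ξ : EuclideanSpace ℝ (Fin n) => (Real.exp (-ε * ‖ξ‖ ^ 2) : ℂ)) with hkdef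
  have hε' : 0 < 1 / (4 * ε) := by positivity
  have hkint : Integrable k := by
    rw [show k = _ from funext hk]
    exact ((integrable_gaussian hε').const_mul _).ofReal
  have hknorm : ∫ x, ‖k x‖ = (2 * Real.pi) ^ n := by
    have : ∀ x, ‖k x‖ = (Real.pi / ε) ^ ((n : ℝ) / 2) * Real.exp (-(1 / (4 * ε)) * ‖x‖ ^ 2) := by
      intro x
      rw [hk, Complex.norm_real, Real.norm_of_nonneg (by positivity)]
    simp_rw [this]
    rw [integral_const_mul, GaussianFourier.integral_rexp_neg_mul_sq_norm hε',
      finrank_euclideanSpace, Fintype.card_fin, ← Real.mul_rpow (by positivity) (by positivity)]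
    have : Real.pi / ε * (Real.pi / (1 / (4 * ε))) = (2 * Real.pi) ^ (2 : ℝ) := by
      rw [Real.rpow_two]; field_simp; ring
    rw [this, ← Real.rpow_mul (by positivity), ← Real.rpow_natCast]
    congr 1; ring
  have h1 := norm_convForm_le_integral (f := fun x => starRingEnd ℂ (f x)) (g := f) hkint
    (fun x => by rw [hk, hk, norm_neg]) (by simpa using hf2) hf2
  rw [hkdef, convForm_fourierExp hGc hcf hf, ← hkdef, hknorm] at h1
  have h2 : ∫ ξ, ((Real.exp (-ε * ‖ξ‖ ^ 2) : ℝ) : ℂ) *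
      fourierExp (fun x => starRingEnd ℂ (f x)) (-ξ) * fourierExp f ξ =
      ((∫ ξ, Real.exp (-ε * ‖ξ‖ ^ 2) * ‖fourierExp f ξ‖ ^ 2 : ℝ) : ℂ) := by
    rw [← integral_complex_ofReal]
    congr 1; ext ξ
    rw [fourierExp_conj, neg_neg, mul_assoc, Complex.conj_mul']
    push_cast; rfl
  rw [h2, Complex.norm_real] at h1
  refine (le_abs_self _).trans (h1.trans (le_of_eq ?_))
  simp

theorem integral_norm_fourierExp_sq_le {f : EuclideanSpace ℝ (Fin n) → ℂ}
    (hf : Integrable f) (hf2 : Integrable (fun x => ‖f x‖ ^ 2)) :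
    Integrable (fun ξ => ‖fourierExp f ξ‖ ^ 2) ∧
      ∫ ξ, ‖fourierExp f ξ‖ ^ 2 ≤ (2 * Real.pi) ^ n * ∫ x, ‖f x‖ ^ 2 := by
  set B := (2 * Real.pi) ^ n * ∫ x, ‖f x‖ ^ 2 with hB
  have hB0 : 0 ≤ B := mul_nonneg (by positivity) (integral_nonneg fun x => by positivity)
  set u : ℕ → ℝ := fun j => 1 / ((j : ℝ) + 1)
  have hu : ∀ j, 0 < u j := fun j => by positivity
  have hut : Filter.Tendsto u Filter.atTop (nhds 0) := tendsto_one_div_add_atTop_nhds_zero_nat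
  have hc := ((continuous_fourierExp hf).norm.pow 2)
  have h1 : ∫⁻ ξ, ENNReal.ofReal (‖fourierExp f ξ‖ ^ 2) ≤ ENNReal.ofReal B := by
    have h2 : ∀ ξ, Filter.liminf (fun j => ENNReal.ofReal
        (Real.exp (-u j * ‖ξ‖ ^ 2) * ‖fourierExp f ξ‖ ^ 2)) Filter.atTop =
        ENNReal.ofReal (‖fourierExp f ξ‖ ^ 2) := by
      intro ξ
      refine Filter.Tendsto.liminf_eq (ENNReal.tendsto_ofReal ?_)
      have : Filter.Tendsto (fun j => Real.exp (-u j * ‖ξ‖ ^ 2) * ‖fourierExp f ξ‖ ^ 2)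
          Filter.atTop (nhds (Real.exp (-0 * ‖ξ‖ ^ 2) * ‖fourierExp f ξ‖ ^ 2)) :=
        (((Real.continuous_exp.tendsto _).comp (hut.neg.mul_const _))).mul_const _
      simpa using this
    calc _ = ∫⁻ ξ, Filter.liminf (fun j => ENNReal.ofReal
        (Real.exp (-u j * ‖ξ‖ ^ 2) * ‖fourierExp f ξ‖ ^ 2)) Filter.atTop := by simp_rw [h2]
      _ ≤ Filter.liminf (fun j => ∫⁻ ξ, ENNReal.ofReal
        (Real.exp (-u j * ‖ξ‖ ^ 2) * ‖fourierExp f ξ‖ ^ 2)) Filter.atTop := by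
          refine lintegral_liminf_le fun j => ?_
          exact (Continuous.mul (by fun_prop) hc).measurable.ennreal_ofReal
      _ ≤ Filter.liminf (fun _ : ℕ => ENNReal.ofReal B) Filter.atTop := by
          refine Filter.liminf_le_liminf (Filter.Eventually.of_forall fun j => ?_)
          obtain ⟨h3, h4⟩ := integral_gaussian_mul_norm_fourierExp_sq_le hf hf2 (hu j)
          rw [← ofReal_integral_eq_lintegral_ofReal h3
            (Filter.Eventually.of_forall fun ξ => by positivity)]
          exact ENNReal.ofReal_le_ofReal h4
      _ = _ := by simp
  have h5 : Integrable (fun ξ => ‖fourierExp f ξ‖ ^ 2) := by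
    refine ⟨hc.aestronglyMeasurable, ?_⟩
    rw [hasFiniteIntegral_iff_ofReal (Filter.Eventually.of_forall fun ξ => by positivity)]
    exact h1.trans_lt ENNReal.ofReal_lt_top
  refine ⟨h5, ?_⟩
  rw [← ofReal_integral_eq_lintegral_ofReal h5
    (Filter.Eventually.of_forall fun ξ => by positivity)] at h1
  exact (ENNReal.ofReal_le_ofReal_iff hB0).1 h1

theorem norm_convForm_fourierExp_le {M f g : EuclideanSpace ℝ (Fin n) → ℂ} {A : ℝ} (hA : 0 ≤ A)
    (hM : Integrable M) (hMA : ∀ᵐ ξ, ‖M ξ‖ ≤ A) (hf : Integrable f)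
    (hf2 : Integrable (fun x => ‖f x‖ ^ 2)) (hg : Integrable g)
    (hg2 : Integrable (fun x => ‖g x‖ ^ 2)) :
    ‖convForm (fourierExp M) f g‖ ≤
      A * (2 * Real.pi) ^ n * (((∫ x, ‖f x‖ ^ 2) + ∫ x, ‖g x‖ ^ 2) / 2) := by
  obtain ⟨h1, h2⟩ := integral_norm_fourierExp_sq_le hf hf2
  obtain ⟨h3, h4⟩ := integral_norm_fourierExp_sq_le hg hg2
  have h5 := h1.comp_neg
  rw [convForm_fourierExp hM hf hg]
  calc _ ≤ ∫ ξ, A * ((‖fourierExp f (-ξ)‖ ^ 2 + ‖fourierExp g ξ‖ ^ 2) / 2) := by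
        refine norm_integral_le_of_norm_le (((h5.add h3).div_const 2).const_mul A) ?_
        filter_upwards [hMA] with ξ hξ
        rw [norm_mul, norm_mul, mul_assoc]
        refine mul_le_mul hξ ?_ (by positivity) hA
        linarith [sq_nonneg (‖fourierExp f (-ξ)‖ - ‖fourierExp g ξ‖)]
    _ = A * (((∫ ξ, ‖fourierExp f ξ‖ ^ 2) + ∫ ξ, ‖fourierExp g ξ‖ ^ 2) / 2) := by
        rw [integral_const_mul, integral_div, integral_add h5 h3,
          integral_neg_eq_self (fun ξ => ‖fourierExp f ξ‖ ^ 2)]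
    _ ≤ A * (((2 * Real.pi) ^ n * (∫ x, ‖f x‖ ^ 2) + (2 * Real.pi) ^ n * ∫ x, ‖g x‖ ^ 2) / 2) := by
        gcongr
    _ = _ := by ring

end BilinearForm

/-- The Fourier integral `x ↦ ∫ exp (i ⟨ω, x⟩) dν(ω)` of a measure. -/
def measureFourier {n : ℕ} (ν : Measure (EuclideanSpace ℝ (Fin n)))
    (x : EuclideanSpace ℝ (Fin n)) : ℂ :=
  ∫ ω, Complex.exp (Complex.I * (⟪ω, x⟫ : ℝ)) ∂ν

theorem fourierExp_gaussian_sub {n : ℕ} {s : ℝ} (hs : 0 < s) (ω x : EuclideanSpace ℝ (Fin n)) :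
    ∫ ξ, Complex.exp (Complex.I * (⟪x, ξ⟫ : ℝ)) * (Real.exp (-(‖ξ - ω‖ ^ 2 / (4 * s))) : ℂ) =
      Complex.exp (Complex.I * (⟪ω, x⟫ : ℝ)) *
        ((4 * Real.pi * s) ^ ((n : ℝ) / 2) * Real.exp (-s * ‖x‖ ^ 2) : ℝ) := by
  have h := fourierExp_gaussian (n := n) (ε := 1 / (4 * s)) (by positivity) x
  rw [← integral_add_right_eq_self _ ω]
  have h1 : ∀ ξ : EuclideanSpace ℝ (Fin n), Complex.exp (Complex.I * (⟪x, ξ + ω⟫ : ℝ)) *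
      (Real.exp (-(‖ξ + ω - ω‖ ^ 2 / (4 * s))) : ℂ) =
      Complex.exp (Complex.I * (⟪ω, x⟫ : ℝ)) * (Complex.exp (Complex.I * (⟪x, ξ⟫ : ℝ)) *
        (Real.exp (-(1 / (4 * s)) * ‖ξ‖ ^ 2) : ℂ)) := by
    intro ξ
    rw [inner_add_right, Complex.ofReal_add, mul_add, Complex.exp_add, add_sub_cancel_right,
      real_inner_comm ω x]
    have : -(‖ξ‖ ^ 2 / (4 * s)) = -(1 / (4 * s)) * ‖ξ‖ ^ 2 := by ring
    rw [this]
    ring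
  simp_rw [h1]
  rw [integral_const_mul]
  congr 1
  refine h.trans ?_
  congr 3
  · field_simp
  · congr 2
    field_simp

section Mollify

variable {n : ℕ} {ν : Measure (EuclideanSpace ℝ (Fin n))} {R : ℝ}

/-- The integrand whose integral over `s` and `ω` is the regularised multiplier. -/
def mollifyIntegrand (n : ℕ) (η : ℝ) (ξ : EuclideanSpace ℝ (Fin n))
    (p : ℝ × EuclideanSpace ℝ (Fin n)) : ℂ :=
  (p.1 : ℂ) ^ (Complex.I * η - 1) * ((Real.exp (-p.1) * p.1 ^ (-(((n : ℝ) - 1) / 2)) *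
    Real.exp (-(‖ξ - p.2‖ ^ 2 / (4 * p.1))) : ℝ) : ℂ)

theorem ae_restrict_prod (hν : IsSpherical ν R) [IsFiniteMeasure ν] (a b : ℝ) :
    ∀ᵐ p ∂((volume.restrict (Set.Ioc a b)).prod ν), p.1 ∈ Set.Ioc a b ∧ ‖p.2‖ = R := by
  have h1 : ∀ᵐ s ∂(volume.restrict (Set.Ioc a b)), s ∈ Set.Ioc a b :=
    ae_restrict_mem measurableSet_Ioc
  exact (Measure.quasiMeasurePreserving_fst.tendsto_ae.eventually h1).and
    (Measure.quasiMeasurePreserving_snd.tendsto_ae.eventually hν.norm_eq)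

theorem integrable_mollifyIntegrand [IsFiniteMeasure ν] (hν : IsSpherical ν R) (hn : 1 ≤ n)
    {η a b : ℝ} (ha : 0 < a) (hab : a ≤ b) :
    Integrable (fun q : EuclideanSpace ℝ (Fin n) × (ℝ × EuclideanSpace ℝ (Fin n)) =>
      mollifyIntegrand n η q.1 q.2)
      ((volume : Measure (EuclideanSpace ℝ (Fin n))).prod
        ((volume.restrict (Set.Ioc a b)).prod ν)) := by
  have hb : 0 < b := ha.trans_le hab
  have hm0 : 0 ≤ ((n : ℝ) - 1) / 2 := by
    have : (1 : ℝ) ≤ n := by exact_mod_cast hn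
    linarith
  set m : ℝ := ((n : ℝ) - 1) / 2
  have hG := (integrable_gaussian (n := n) (ε := 1 / (8 * b)) (by positivity)).const_mul
    (a⁻¹ * (1 * a ^ (-m) * Real.exp (R ^ 2 / (4 * b))))
  have hG2 := hG.mul_prod (ν := (volume.restrict (Set.Ioc a b)).prod ν) (integrable_const (1 : ℝ))
  refine hG2.mono' ?_ ?_
  · refine Measurable.aestronglyMeasurable ?_
    unfold mollifyIntegrand
    fun_prop
  · filter_upwards [Measure.quasiMeasurePreserving_snd.tendsto_ae.eventually
      (ae_restrict_prod hν a b)] with q hq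
    obtain ⟨⟨h1, h2⟩, h3⟩ := hq
    have hs : 0 < q.2.1 := ha.trans h1
    rw [mollifyIntegrand, norm_mul, Complex.norm_cpow_eq_rpow_re_of_pos hs, Complex.norm_real,
      Real.norm_of_nonneg (by positivity)]
    have e0 : (Complex.I * (η : ℂ) - 1).re = -1 := by simp
    rw [e0, Real.rpow_neg_one, mul_one]
    change q.2.1⁻¹ * (Real.exp (-q.2.1) * q.2.1 ^ (-m) *
      Real.exp (-(‖q.1 - q.2.2‖ ^ 2 / (4 * q.2.1)))) ≤ _
    have e1 : q.2.1⁻¹ ≤ a⁻¹ := inv_anti₀ ha h1.le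
    have e2 : Real.exp (-q.2.1) ≤ 1 := Real.exp_le_one_iff.2 (by linarith)
    have e3 : q.2.1 ^ (-m) ≤ a ^ (-m) := Real.rpow_le_rpow_of_nonpos ha h1.le (by linarith)
    have e4 : Real.exp (-(‖q.1 - q.2.2‖ ^ 2 / (4 * q.2.1))) ≤
        Real.exp (R ^ 2 / (4 * b)) * Real.exp (-(1 / (8 * b)) * ‖q.1‖ ^ 2) := by
      rw [← Real.exp_add]
      gcongr
      have f1 : ‖q.1‖ ≤ ‖q.1 - q.2.2‖ + R := by
        rw [← h3]
        simpa using norm_add_le (q.1 - q.2.2) q.2.2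
      have f2 : ‖q.1‖ ^ 2 / 2 - R ^ 2 ≤ ‖q.1 - q.2.2‖ ^ 2 := by
        nlinarith [sq_nonneg (‖q.1 - q.2.2‖ - R), norm_nonneg q.1, norm_nonneg (q.1 - q.2.2)]
      have f3 : ‖q.1 - q.2.2‖ ^ 2 / (4 * b) ≤ ‖q.1 - q.2.2‖ ^ 2 / (4 * q.2.1) := by gcongr
      have f4 : (‖q.1‖ ^ 2 / 2 - R ^ 2) / (4 * b) ≤ ‖q.1 - q.2.2‖ ^ 2 / (4 * b) := by gcongr
      have f5 : (‖q.1‖ ^ 2 / 2 - R ^ 2) / (4 * b) =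
          -(R ^ 2 / (4 * b) + -(1 / (8 * b)) * ‖q.1‖ ^ 2) := by field_simp; ring
      linarith
    calc _ ≤ a⁻¹ * (1 * a ^ (-m) *
          (Real.exp (R ^ 2 / (4 * b)) * Real.exp (-(1 / (8 * b)) * ‖q.1‖ ^ 2))) := by gcongr
      _ = _ := by ring

/-- The regularised multiplier. -/
def mollified (ν : Measure (EuclideanSpace ℝ (Fin n))) (η a b : ℝ)
    (ξ : EuclideanSpace ℝ (Fin n)) : ℂ :=
  ∫ p, mollifyIntegrand n η ξ p ∂((volume.restrict (Set.Ioc a b)).prod ν)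

theorem fourierExp_mollified [IsFiniteMeasure ν] (hν : IsSpherical ν R) (hn : 1 ≤ n)
    {η a b : ℝ} (ha : 0 < a) (hab : a ≤ b) (x : EuclideanSpace ℝ (Fin n)) :
    fourierExp (mollified ν η a b) x = ((4 * Real.pi) ^ ((n : ℝ) / 2) : ℝ) *
      ((∫ s in Set.Ioc a b, (s : ℂ) ^ (Complex.I * η - 1 / 2) *
        (Real.exp (-((1 + ‖x‖ ^ 2) * s)) : ℂ)) * measureFourier ν x) := by
  have hint := integrable_mollifyIntegrand hν hn (η := η) ha hab
  have hint2 : Integrable (fun q : EuclideanSpace ℝ (Fin n) × (ℝ × EuclideanSpace ℝ (Fin n)) =>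
      Complex.exp (Complex.I * (⟪x, q.1⟫ : ℝ)) * mollifyIntegrand n η q.1 q.2)
      ((volume : Measure (EuclideanSpace ℝ (Fin n))).prod
        ((volume.restrict (Set.Ioc a b)).prod ν)) := by
    refine hint.bdd_mul (c := 1)
      (Continuous.aestronglyMeasurable (by fun_prop)) (Filter.Eventually.of_forall fun q => ?_)
    rw [norm_exp_I_mul_ofReal]
  calc fourierExp (mollified ν η a b) x
      = ∫ ξ, ∫ p, Complex.exp (Complex.I * (⟪x, ξ⟫ : ℝ)) * mollifyIntegrand n η ξ p
          ∂((volume.restrict (Set.Ioc a b)).prod ν) := by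
        rw [fourierExp]
        congr 1; ext ξ
        rw [mollified, integral_const_mul]
    _ = ∫ p, (∫ ξ, Complex.exp (Complex.I * (⟪x, ξ⟫ : ℝ)) * mollifyIntegrand n η ξ p)
          ∂((volume.restrict (Set.Ioc a b)).prod ν) := integral_integral_swap hint2
    _ = ∫ p, ((4 * Real.pi) ^ ((n : ℝ) / 2) : ℝ) * (((p.1 : ℂ) ^ (Complex.I * η - 1 / 2) *
        (Real.exp (-((1 + ‖x‖ ^ 2) * p.1)) : ℂ)) * Complex.exp (Complex.I * (⟪p.2, x⟫ : ℝ)))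
          ∂((volume.restrict (Set.Ioc a b)).prod ν) := by
        refine integral_congr_ae ?_
        filter_upwards [ae_restrict_prod hν a b] with p hp
        have hs : 0 < p.1 := ha.trans hp.1.1
        have h1 : ∀ ξ : EuclideanSpace ℝ (Fin n),
            Complex.exp (Complex.I * (⟪x, ξ⟫ : ℝ)) * mollifyIntegrand n η ξ p =
            ((p.1 : ℂ) ^ (Complex.I * η - 1) *
              ((Real.exp (-p.1) * p.1 ^ (-(((n : ℝ) - 1) / 2)) : ℝ) : ℂ)) *
            (Complex.exp (Complex.I * (⟪x, ξ⟫ : ℝ)) *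
              (Real.exp (-(‖ξ - p.2‖ ^ 2 / (4 * p.1))) : ℂ)) := by
          intro ξ
          rw [mollifyIntegrand, Complex.ofReal_mul]
          ring
        simp_rw [h1]
        rw [integral_const_mul, fourierExp_gaussian_sub hs]
        have hs0 : (p.1 : ℂ) ≠ 0 := by exact_mod_cast hs.ne'
        have h2 : (p.1 : ℂ) ^ (Complex.I * η - 1 / 2) = (p.1 : ℂ) ^ (Complex.I * η - 1) *
            ((p.1 ^ (1 / 2 : ℝ) : ℝ) : ℂ) := by
          rw [Complex.ofReal_cpow hs.le, ← Complex.cpow_add _ _ hs0]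
          congr 1
          push_cast
          ring
        have h3 : p.1 ^ (1 / 2 : ℝ) = p.1 ^ (-(((n : ℝ) - 1) / 2)) * p.1 ^ ((n : ℝ) / 2) := by
          rw [← Real.rpow_add hs]
          congr 1
          ring
        have h4 : Real.exp (-((1 + ‖x‖ ^ 2) * p.1)) =
            Real.exp (-p.1) * Real.exp (-p.1 * ‖x‖ ^ 2) := by
          rw [← Real.exp_add]
          congr 1
          ring
        rw [h2, h3, h4, Real.mul_rpow (by positivity) hs.le]
        push_cast
        ring
    _ = _ := by
        rw [integral_const_mul, integral_prod_mul (fun s : ℝ => (s : ℂ) ^ (Complex.I * η - 1 / 2) *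
          (Real.exp (-((1 + ‖x‖ ^ 2) * s)) : ℂ))
          (fun ω => Complex.exp (Complex.I * (⟪ω, x⟫ : ℝ)))]
        rfl

theorem exists_norm_mollified_le [IsFiniteMeasure ν] (hν : IsSpherical ν R) (hR : 0 < R)
    (hn : 1 ≤ n) : ∃ C, 0 ≤ C ∧ ∀ η a b : ℝ, η ≠ 0 → 0 < a → a ≤ b →
      Integrable (mollified ν η a b) ∧ ∀ᵐ ξ, ‖mollified ν η a b ξ‖ ≤ C / |η| := by
  obtain ⟨C, hC0, hC⟩ := hν.exists_norm_integral_profile_le hR hn ⟨0, hn⟩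
  refine ⟨C, hC0, fun η a b hη ha hab => ?_⟩
  have hint := integrable_mollifyIntegrand hν hn (η := η) ha hab
  refine ⟨hint.integral_prod_left, ?_⟩
  have hne : ∀ᵐ ξ : EuclideanSpace ℝ (Fin n), ξ ≠ 0 := by
    have : Nonempty (Fin n) := ⟨⟨0, hn⟩⟩
    exact Measure.ae_ne volume 0
  filter_upwards [hint.prod_right_ae, hne] with ξ hξ hξ0
  have h1 : mollified ν η a b ξ = ∫ s in a..b, (s : ℂ) ^ (Complex.I * η - 1) *
      (IsSpherical.profile ν R ⟨0, hn⟩ ‖ξ‖ s : ℂ) := by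
    rw [mollified, integral_prod _ hξ, intervalIntegral.integral_of_le hab]
    refine setIntegral_congr_fun measurableSet_Ioc fun s hs => ?_
    have hs0 : 0 < s := ha.trans hs.1
    simp only [mollifyIntegrand]
    rw [integral_const_mul, integral_complex_ofReal, integral_const_mul,
      hν.integral_exp_norm_sub ⟨0, hn⟩ ξ hs0]
    rfl
  rw [h1]
  exact hC _ _ _ _ (norm_pos_iff.2 hξ0) hη ha hab

end Mollify

section LimitKernel

variable {n : ℕ} {ν : Measure (EuclideanSpace ℝ (Fin n))} {R : ℝ}

theorem tendsto_convForm {k : ℕ → EuclideanSpace ℝ (Fin n) → ℂ} {k₀ : EuclideanSpace ℝ (Fin n) → ℂ}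
    {B : ℝ} (hk : ∀ j, Continuous (k j)) (hB : ∀ j x, ‖k j x‖ ≤ B)
    (hlim : ∀ x, Filter.Tendsto (fun j => k j x) Filter.atTop (nhds (k₀ x)))
    {f g : EuclideanSpace ℝ (Fin n) → ℂ} (hf : Integrable f) (hg : Integrable g) :
    Filter.Tendsto (fun j => convForm (k j) f g) Filter.atTop (nhds (convForm k₀ f g)) := by
  have hfg : Integrable (fun p : EuclideanSpace ℝ (Fin n) × EuclideanSpace ℝ (Fin n) =>
      g p.1 * f p.2) := hg.mul_prod hf
  refine tendsto_integral_of_dominated_convergence (fun p => B * ‖g p.1 * f p.2‖) ?_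
    (hfg.norm.const_mul B) ?_ ?_
  · intro j
    have h1 : AEStronglyMeasurable
        (fun p : EuclideanSpace ℝ (Fin n) × EuclideanSpace ℝ (Fin n) => k j (p.1 - p.2)) :=
      ((hk j).comp (by fun_prop)).aestronglyMeasurable
    refine (h1.mul hfg.1).congr (Filter.Eventually.of_forall fun p => ?_)
    simp only [Pi.mul_apply]
    ring
  · intro j
    refine Filter.Eventually.of_forall fun p => ?_
    rw [mul_assoc, norm_mul, mul_comm (f p.2)]
    gcongr
    exact hB j _
  · refine Filter.Eventually.of_forall fun p => ?_
    exact ((hlim _).mul_const _).mul_const _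

theorem integrableOn_cpow_mul_exp (η : ℝ) {A : ℝ} (hA : 1 ≤ A) :
    IntegrableOn (fun s : ℝ => (s : ℂ) ^ (Complex.I * η - 1 / 2) * (Real.exp (-(A * s)) : ℂ))
      (Set.Ioi 0) ∧ ∀ s ∈ Set.Ioi (0 : ℝ),
      ‖(s : ℂ) ^ (Complex.I * η - 1 / 2) * (Real.exp (-(A * s)) : ℂ)‖ ≤
        Real.exp (-s) * s ^ ((1 / 2 : ℝ) - 1) := by
  have hb : ∀ s ∈ Set.Ioi (0 : ℝ),
      ‖(s : ℂ) ^ (Complex.I * η - 1 / 2) * (Real.exp (-(A * s)) : ℂ)‖ ≤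
        Real.exp (-s) * s ^ ((1 / 2 : ℝ) - 1) := by
    intro s hs
    have hs0 : (0 : ℝ) < s := hs
    rw [norm_mul, Complex.norm_cpow_eq_rpow_re_of_pos hs0, Complex.norm_real,
      Real.norm_of_nonneg (Real.exp_pos _).le, mul_comm]
    have e : (Complex.I * (η : ℂ) - 1 / 2).re = 1 / 2 - 1 := by
      simp
      norm_num
    rw [e]
    gcongr
    nlinarith
  refine ⟨?_, hb⟩
  refine Integrable.mono' (Real.GammaIntegral_convergent (by norm_num : (0 : ℝ) < 1 / 2)) ?_ ?_
  · exact Measurable.aestronglyMeasurable (by fun_prop)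
  · exact (ae_restrict_iff' measurableSet_Ioi).2 (Filter.Eventually.of_forall hb)

theorem tendsto_setIntegral_cpow_mul_exp (η : ℝ) {A : ℝ} (hA : 1 ≤ A) :
    Filter.Tendsto (fun j : ℕ => ∫ s in Set.Ioc (1 / ((j : ℝ) + 1)) ((j : ℝ) + 1),
      (s : ℂ) ^ (Complex.I * η - 1 / 2) * (Real.exp (-(A * s)) : ℂ)) Filter.atTop
      (nhds (Complex.Gamma (1 / 2 + Complex.I * η) * (A : ℂ) ^ (-(1 / 2 + Complex.I * η)))) := by
  obtain ⟨h1, h2⟩ := integrableOn_cpow_mul_exp η hA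
  have hA0 : 0 < A := by linarith
  set F : ℝ → ℂ := fun s => (s : ℂ) ^ (Complex.I * η - 1 / 2) * (Real.exp (-(A * s)) : ℂ) with hF
  have h3 : ∫ s in Set.Ioi (0 : ℝ), F s =
      Complex.Gamma (1 / 2 + Complex.I * η) * (A : ℂ) ^ (-(1 / 2 + Complex.I * η)) := by
    have := Complex.integral_cpow_mul_exp_neg_mul_Ioi (a := 1 / 2 + Complex.I * η) (r := A)
      (by simp) hA0
    rw [one_div (A : ℂ), Complex.inv_cpow _ _ (by
      rw [Complex.arg_ofReal_of_nonneg hA0.le]; exact Real.pi_pos.ne), ← Complex.cpow_neg] at this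
    rw [mul_comm, ← this]
    refine setIntegral_congr_fun measurableSet_Ioi fun s _ => ?_
    simp only [hF]
    congr 1
    · congr 1; ring
    · push_cast; rfl
  rw [← h3]
  have h4 : ∀ j : ℕ, ∫ s in Set.Ioc (1 / ((j : ℝ) + 1)) ((j : ℝ) + 1), F s =
      ∫ s in Set.Ioi (0 : ℝ), (Set.Ioc (1 / ((j : ℝ) + 1)) ((j : ℝ) + 1)).indicator F s := by
    intro j
    rw [setIntegral_indicator measurableSet_Ioc]
    congr 2
    ext s
    simp only [Set.mem_inter_iff, Set.mem_Ioi, Set.mem_Ioc]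
    have : 0 < 1 / ((j : ℝ) + 1) := by positivity
    constructor
    · rintro h; exact ⟨this.trans h.1, h⟩
    · rintro h; exact h.2
  simp_rw [h4]
  refine tendsto_integral_of_dominated_convergence (fun s => ‖F s‖) ?_ h1.norm ?_ ?_
  · intro j
    exact h1.1.indicator measurableSet_Ioc
  · intro j
    exact Filter.Eventually.of_forall fun s => norm_indicator_le_norm_self _ _
  · refine (ae_restrict_iff' measurableSet_Ioi).2 (Filter.Eventually.of_forall fun s hs => ?_)
    have hs0 : (0 : ℝ) < s := hs
    refine tendsto_const_nhds.congr' ?_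
    have e1 : ∀ᶠ j : ℕ in Filter.atTop, 1 / ((j : ℝ) + 1) < s :=
      tendsto_one_div_add_atTop_nhds_zero_nat.eventually_lt_const hs0
    have e2 : ∀ᶠ j : ℕ in Filter.atTop, s ≤ (j : ℝ) + 1 :=
      (Filter.tendsto_atTop_add_const_right _ _ tendsto_natCast_atTop_atTop).eventually_ge_atTop s
    filter_upwards [e1, e2] with j h5 h6
    rw [Set.indicator_of_mem (show s ∈ Set.Ioc _ _ from ⟨h5, h6⟩)]

theorem norm_measureFourier_le [IsFiniteMeasure ν] (x : EuclideanSpace ℝ (Fin n)) :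
    ‖measureFourier ν x‖ ≤ ν.real Set.univ := by
  refine (norm_integral_le_integral_norm _).trans (le_of_eq ?_)
  simp_rw [norm_exp_I_mul_ofReal]
  simp

theorem continuous_measureFourier [IsFiniteMeasure ν] : Continuous (measureFourier ν) := by
  refine continuous_of_dominated (bound := fun _ => (1 : ℝ)) ?_ ?_ (integrable_const _) ?_
  · intro x
    exact Continuous.aestronglyMeasurable (by fun_prop)
  · intro x
    exact Filter.Eventually.of_forall fun ω => (norm_exp_I_mul_ofReal _).le
  · exact Filter.Eventually.of_forall fun x => by fun_prop

theorem convForm_const_mul (c : ℂ) (k f g : EuclideanSpace ℝ (Fin n) → ℂ) :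
    convForm (fun x => c * k x) f g = c * convForm k f g := by
  rw [convForm, convForm, ← integral_const_mul]
  congr 1; ext p; ring

theorem exists_norm_convForm_damped_le [IsFiniteMeasure ν] (hν : IsSpherical ν R) (hR : 0 < R)
    (hn : 1 ≤ n) : ∃ C, 0 ≤ C ∧ ∀ (η : ℝ) (f g : EuclideanSpace ℝ (Fin n) → ℂ), η ≠ 0 →
      Integrable f → Integrable (fun x => ‖f x‖ ^ 2) → Integrable g →
      Integrable (fun x => ‖g x‖ ^ 2) →
      ‖Complex.Gamma (1 / 2 + Complex.I * η)‖ * ‖convForm (fun x => measureFourier ν x *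
        ((1 + ‖x‖ ^ 2 : ℝ) : ℂ) ^ (-(1 / 2 + Complex.I * η))) f g‖ ≤
        C / |η| * (((∫ x, ‖f x‖ ^ 2) + ∫ x, ‖g x‖ ^ 2) / 2) := by
  obtain ⟨C, hC0, hC⟩ := exists_norm_mollified_le hν hR hn
  set c₀ : ℝ := (4 * Real.pi) ^ ((n : ℝ) / 2) with hc₀
  have hc₀0 : 0 < c₀ := by positivity
  refine ⟨C * (2 * Real.pi) ^ n / c₀, by positivity, fun η f g hη hf hf2 hg hg2 => ?_⟩
  set k : ℕ → EuclideanSpace ℝ (Fin n) → ℂ := fun j =>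
    fourierExp (mollified ν η (1 / ((j : ℝ) + 1)) ((j : ℝ) + 1)) with hk
  have hj0 : ∀ j : ℕ, 0 < 1 / ((j : ℝ) + 1) := fun j => by positivity
  have hjle : ∀ j : ℕ, 1 / ((j : ℝ) + 1) ≤ (j : ℝ) + 1 := by
    intro j
    have hj : (1 : ℝ) ≤ (j : ℝ) + 1 := by
      have : (0 : ℝ) ≤ j := j.cast_nonneg
      linarith
    exact (div_le_one_of_le₀ hj (by positivity)).trans hj
  have hkx : ∀ j x, k j x = (c₀ : ℂ) * ((∫ s in Set.Ioc (1 / ((j : ℝ) + 1)) ((j : ℝ) + 1),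
      (s : ℂ) ^ (Complex.I * η - 1 / 2) * (Real.exp (-((1 + ‖x‖ ^ 2) * s)) : ℂ)) *
        measureFourier ν x) := fun j x => fourierExp_mollified hν hn (hj0 j) (hjle j) x
  have hx1 : ∀ x : EuclideanSpace ℝ (Fin n), 1 ≤ 1 + ‖x‖ ^ 2 := fun x => by
    have := sq_nonneg ‖x‖
    linarith
  set Γ := Complex.Gamma (1 / 2 + Complex.I * η) with hΓ
  have hlim : ∀ x, Filter.Tendsto (fun j => k j x) Filter.atTop (nhds ((c₀ * Γ : ℂ) *
      (measureFourier ν x * ((1 + ‖x‖ ^ 2 : ℝ) : ℂ) ^ (-(1 / 2 + Complex.I * η))))) := by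
    intro x
    simp_rw [hkx]
    have := ((tendsto_setIntegral_cpow_mul_exp η (hx1 x)).mul_const
      (measureFourier ν x)).const_mul (c₀ : ℂ)
    convert this using 2
    ring
  set B₀ := ∫ s in Set.Ioi (0 : ℝ), Real.exp (-s) * s ^ ((1 / 2 : ℝ) - 1) with hB₀
  have hGi := Real.GammaIntegral_convergent (by norm_num : (0 : ℝ) < 1 / 2)
  have hB : ∀ j x, ‖k j x‖ ≤ c₀ * (B₀ * ν.real Set.univ) := by
    intro j x
    rw [hkx, norm_mul, norm_mul, Complex.norm_real, Real.norm_of_nonneg hc₀0.le]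
    have h1 : ‖∫ s in Set.Ioc (1 / ((j : ℝ) + 1)) ((j : ℝ) + 1),
        (s : ℂ) ^ (Complex.I * η - 1 / 2) * (Real.exp (-((1 + ‖x‖ ^ 2) * s)) : ℂ)‖ ≤ B₀ := by
      have hsub : Set.Ioc (1 / ((j : ℝ) + 1)) ((j : ℝ) + 1) ⊆ Set.Ioi 0 :=
        fun s hs => (hj0 j).trans hs.1
      calc _ ≤ ∫ s in Set.Ioc (1 / ((j : ℝ) + 1)) ((j : ℝ) + 1),
            Real.exp (-s) * s ^ ((1 / 2 : ℝ) - 1) := by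
            refine norm_integral_le_of_norm_le (hGi.mono_set hsub) ?_
            exact (ae_restrict_iff' measurableSet_Ioc).2 (Filter.Eventually.of_forall fun s hs =>
              (integrableOn_cpow_mul_exp η (hx1 x)).2 s (hsub hs))
        _ ≤ B₀ := by
            refine setIntegral_mono_set hGi ?_ hsub.eventuallyLE
            refine (ae_restrict_iff' measurableSet_Ioi).2
              (Filter.Eventually.of_forall fun s hs => ?_)
            have hs0 : (0 : ℝ) < s := hs
            simp only [Pi.zero_apply]
            positivity
    have h2 := norm_measureFourier_le (ν := ν) x
    have h3 : 0 ≤ B₀ := (norm_nonneg _).trans h1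
    gcongr
  have hcont : ∀ j, Continuous (k j) := fun j =>
    continuous_fourierExp (hC η _ _ hη (hj0 j) (hjle j)).1
  have htend := (tendsto_convForm hcont hB hlim hf hg).norm
  have hbd : ∀ j, ‖convForm (k j) f g‖ ≤
      C / |η| * (2 * Real.pi) ^ n * (((∫ x, ‖f x‖ ^ 2) + ∫ x, ‖g x‖ ^ 2) / 2) := fun j =>
    norm_convForm_fourierExp_le (by positivity) (hC η _ _ hη (hj0 j) (hjle j)).1
      (hC η _ _ hη (hj0 j) (hjle j)).2 hf hf2 hg hg2
  have hfin := le_of_tendsto' htend hbd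
  rw [convForm_const_mul, norm_mul, norm_mul, Complex.norm_real, Real.norm_of_nonneg hc₀0.le,
    mul_assoc, mul_comm, ← le_div_iff₀ hc₀0] at hfin
  refine hfin.trans (le_of_eq ?_)
  ring

end LimitKernel

section AnalyticFamily

/-- Exponential families `z ↦ ∫ a exp (b + z c)` with bounded `b, c` are entire. -/
theorem differentiable_integral_exp_family {X : Type*} [MeasurableSpace X] {μ : Measure X}
    {a : X → ℂ} {b c : X → ℝ} {B : ℝ} (ha : Integrable a μ) (hbm : Measurable b)
    (hcm : Measurable c) (hb : ∀ x, a x ≠ 0 → |b x| ≤ B) (hc : ∀ x, a x ≠ 0 → |c x| ≤ B) :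
    Differentiable ℂ (fun z : ℂ => ∫ x, a x * Complex.exp (b x + z * c x) ∂μ) := by
  intro z₀
  have hbound : ∀ x, ∀ z : ℂ, ‖a x * Complex.exp (b x + z * c x)‖ ≤
      ‖a x‖ * Real.exp (B + ‖z‖ * B) := by
    intro x z
    by_cases h : a x = 0
    · simp [h]
    rw [norm_mul, Complex.norm_exp]
    gcongr
    simp only [Complex.add_re, Complex.ofReal_re, Complex.mul_re, Complex.ofReal_im, mul_zero,
      sub_zero]
    refine add_le_add ((le_abs_self _).trans (hb x h)) ((le_abs_self _).trans ?_)
    rw [abs_mul]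
    exact mul_le_mul (Complex.abs_re_le_norm z) (hc x h) (abs_nonneg _) (norm_nonneg _)
  have hmeas : ∀ z : ℂ, AEStronglyMeasurable (fun x => a x * Complex.exp (b x + z * c x)) μ :=
    fun z => ha.1.mul (Measurable.aestronglyMeasurable (by fun_prop))
  refine (hasDerivAt_integral_of_dominated_loc_of_deriv_le (μ := μ)
    (F := fun (z : ℂ) x => a x * Complex.exp (b x + z * c x))
    (F' := fun (z : ℂ) x => a x * Complex.exp (b x + z * c x) * c x)
    (bound := fun x => ‖a x‖ * Real.exp (B + (‖z₀‖ + 1) * |B|) * |B|)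
    (Metric.ball_mem_nhds z₀ one_pos) (Filter.Eventually.of_forall hmeas) ?_ ?_ ?_ ?_
    ?_).2.differentiableAt
  · exact (ha.norm.mul_const _).mono' (hmeas z₀) (Filter.Eventually.of_forall fun x => hbound x z₀)
  · exact (hmeas z₀).mul (Measurable.aestronglyMeasurable (by fun_prop))
  · refine Filter.Eventually.of_forall fun x z hz => ?_
    by_cases h : a x = 0
    · simp [h]
    have hz1 : ‖z‖ ≤ ‖z₀‖ + 1 := by
      have h1 := norm_sub_norm_le z z₀
      have h2 : ‖z - z₀‖ < 1 := by simpa [dist_eq_norm] using hz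
      linarith
    have hB0 : 0 ≤ B := (abs_nonneg _).trans (hb x h)
    have hBB : B ≤ |B| := le_abs_self B
    rw [norm_mul, Complex.norm_real, Real.norm_eq_abs]
    refine mul_le_mul ((hbound x z).trans ?_) ((hc x h).trans hBB) (abs_nonneg _) (by positivity)
    gcongr
  · exact (ha.norm.mul_const _).mul_const _
  · refine Filter.Eventually.of_forall fun x z _ => ?_
    have h1 : HasDerivAt (fun z : ℂ => (b x : ℂ) + z * c x) (c x : ℂ) z := by
      simpa using ((hasDerivAt_id z).mul_const (c x : ℂ)).const_add (b x : ℂ)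
    refine (h1.cexp.const_mul (a x)).congr_deriv ?_
    ring

theorem norm_integral_exp_family_le {X : Type*} [MeasurableSpace X] {μ : Measure X}
    {a : X → ℂ} {b c : X → ℝ} {B : ℝ} (ha : Integrable a μ)
    (hb : ∀ x, a x ≠ 0 → |b x| ≤ B) (hc : ∀ x, a x ≠ 0 → |c x| ≤ B) {z : ℂ}
    (hz0 : 0 ≤ z.re) (hz1 : z.re ≤ 1) :
    ‖∫ x, a x * Complex.exp (b x + z * c x) ∂μ‖ ≤ (∫ x, ‖a x‖ ∂μ) * Real.exp (B + B) := by
  rw [← integral_mul_const]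
  refine norm_integral_le_of_norm_le (ha.norm.mul_const _) (Filter.Eventually.of_forall fun x => ?_)
  by_cases h : a x = 0
  · simp [h]
  rw [norm_mul, Complex.norm_exp]
  gcongr
  simp only [Complex.add_re, Complex.ofReal_re, Complex.mul_re, Complex.ofReal_im, mul_zero,
    sub_zero]
  refine add_le_add ((le_abs_self _).trans (hb x h)) ((le_abs_self _).trans ?_)
  rw [abs_mul, abs_of_nonneg hz0]
  exact (mul_le_of_le_one_left (abs_nonneg _) hz1).trans (hc x h)

theorem norm_one_sub_mul_exp_sq_le {z : ℂ} (hz0 : 0 ≤ z.re) (hz1 : z.re ≤ 1) :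
    ‖(1 - z) * Complex.exp (z ^ 2)‖ ≤ Real.exp 1 := by
  have h1 : ‖1 - z‖ ≤ Real.exp (z.im ^ 2) := by
    refine abs_le_of_sq_le_sq' ?_ (Real.exp_pos _).le |>.2
    rw [← Complex.normSq_eq_norm_sq, Complex.normSq_apply]
    have h2 := Real.add_one_le_exp (z.im ^ 2)
    have h3 : 1 ≤ Real.exp (z.im ^ 2) := Real.one_le_exp (sq_nonneg _)
    simp only [Complex.sub_re, Complex.one_re, Complex.sub_im, Complex.one_im]
    nlinarith
  have h4 : (z ^ 2).re ≤ 1 - z.im ^ 2 := by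
    simp only [sq, Complex.mul_re]
    nlinarith
  rw [norm_mul, Complex.norm_exp]
  calc _ ≤ Real.exp (z.im ^ 2) * Real.exp (1 - z.im ^ 2) := by gcongr
    _ = Real.exp 1 := by rw [← Real.exp_add]; congr 1; ring

theorem exp_le_norm_Gamma_half (η : ℝ) :
    Real.exp (-(Real.pi * |η| / 2)) ≤ ‖Complex.Gamma (1 / 2 + Complex.I * η)‖ := by
  set w : ℂ := 1 / 2 + Complex.I * η with hw
  have h1 : Complex.Gamma (1 - w) = starRingEnd ℂ (Complex.Gamma w) := by
    rw [← Complex.Gamma_conj]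
    congr 1
    simp only [hw, map_add, map_mul, Complex.conj_I, Complex.conj_ofReal, map_div₀, map_one,
      map_ofNat]
    ring
  have h2 := Complex.Gamma_mul_Gamma_one_sub w
  have h3 : Complex.sin (Real.pi * w) = (Real.cosh (Real.pi * η) : ℂ) := by
    have : (Real.pi : ℂ) * w = Real.pi / 2 - (-(Real.pi * η : ℂ)) * Complex.I := by
      rw [hw]; ring
    rw [this, Complex.sin_pi_div_two_sub, Complex.cos_mul_I, Complex.cosh_neg]
    push_cast; rfl
  rw [h1, h3, Complex.mul_conj, Complex.normSq_eq_norm_sq] at h2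
  have h4 : ‖Complex.Gamma w‖ ^ 2 = Real.pi / Real.cosh (Real.pi * η) := by exact_mod_cast h2
  refine (abs_le_of_sq_le_sq' ?_ (norm_nonneg _)).2
  rw [h4, le_div_iff₀ (Real.cosh_pos _), ← Real.exp_nat_mul, ← Real.cosh_abs, abs_mul,
    abs_of_pos Real.pi_pos, Real.cosh_eq]
  have h5 : Real.exp (-(Real.pi * |η|)) ≤ 1 := Real.exp_le_one_iff.2 (by
    have := Real.pi_pos; have := abs_nonneg η; nlinarith)
  have h6 : Real.exp (((2 : ℕ) : ℝ) * -(Real.pi * |η| / 2)) = Real.exp (-(Real.pi * |η|)) := by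
    congr 1; push_cast; ring
  rw [h6]
  have h7 : Real.exp (-(Real.pi * |η|)) * Real.exp (Real.pi * |η|) = 1 := by
    rw [← Real.exp_add]; simp
  have h8 := Real.pi_gt_three
  have h9 := Real.exp_pos (-(Real.pi * |η|))
  nlinarith

end AnalyticFamily

section TameFunctions

variable {n : ℕ}

/-- Measurable functions with bounded support which are bounded above and below on it. -/
def IsTame (f : EuclideanSpace ℝ (Fin n) → ℂ) : Prop :=
  Measurable f ∧ ∃ M, 0 < M ∧ ∀ x, f x ≠ 0 → ‖x‖ ≤ M ∧ M⁻¹ ≤ ‖f x‖ ∧ ‖f x‖ ≤ M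

theorem integrable_of_bounded_support {G : Type*} [NormedAddCommGroup G]
    {h : EuclideanSpace ℝ (Fin n) → G} {B M : ℝ}
    (hm : AEStronglyMeasurable h) (hB : ∀ x, ‖h x‖ ≤ B) (hM : ∀ x, h x ≠ 0 → ‖x‖ ≤ M) :
    Integrable h := by
  have hsub : Function.support h ⊆ Metric.closedBall 0 M := fun x hx => by simpa using hM x hx
  rw [← integrableOn_iff_integrable_of_support_subset hsub]
  have : IsFiniteMeasure (volume.restrict (Metric.closedBall (0 : EuclideanSpace ℝ (Fin n)) M)) :=
    ⟨by simpa using measure_closedBall_lt_top⟩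
  exact Integrable.of_bound hm.restrict B (Filter.Eventually.of_forall hB)

theorem IsTame.abs_log_le {f : EuclideanSpace ℝ (Fin n) → ℂ} (hf : IsTame f) :
    ∃ B, ∀ x, |Real.log ‖f x‖| ≤ B := by
  obtain ⟨-, M, hM, h⟩ := hf
  refine ⟨|Real.log M|, fun x => ?_⟩
  by_cases hx : f x = 0
  · simp [hx]
  obtain ⟨-, h1, h2⟩ := h x hx
  have h3 : 0 < ‖f x‖ := norm_pos_iff.2 hx
  refine abs_le.2 ⟨?_, (Real.log_le_log h3 h2).trans (le_abs_self _)⟩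
  have := Real.log_le_log (by positivity) h1
  rw [Real.log_inv] at this
  linarith [le_abs_self (Real.log M)]

/-- Stein's analytic family through `f`. -/
def steinFamily (p : ℝ) (f : EuclideanSpace ℝ (Fin n) → ℂ) (z : ℂ)
    (x : EuclideanSpace ℝ (Fin n)) : ℂ :=
  f x / ‖f x‖ * Complex.exp (p * (1 - z / 2) * Real.log ‖f x‖)

theorem measurable_steinFamily {f : EuclideanSpace ℝ (Fin n) → ℂ} (hf : Measurable f) (p : ℝ)
    (z : ℂ) : Measurable (steinFamily p f z) := by
  unfold steinFamily
  fun_prop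

theorem norm_steinFamily {p : ℝ} (hp : 0 < p) (f : EuclideanSpace ℝ (Fin n) → ℂ) {z : ℂ}
    (hz : z.re < 2) (x : EuclideanSpace ℝ (Fin n)) :
    ‖steinFamily p f z x‖ = ‖f x‖ ^ (p * (1 - z.re / 2)) := by
  have hs : 0 < p * (1 - z.re / 2) := mul_pos hp (by linarith)
  by_cases hx : f x = 0
  · simp [steinFamily, hx, Real.zero_rpow hs.ne']
  have h3 : 0 < ‖f x‖ := norm_pos_iff.2 hx
  rw [steinFamily, norm_mul, norm_div, Complex.norm_real, norm_norm, div_self h3.ne', one_mul,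
    Complex.norm_exp, Real.rpow_def_of_pos h3]
  congr 1
  rw [Complex.re_mul_ofReal, Complex.re_ofReal_mul]
  simp
  ring

theorem steinFamily_eq_self {p : ℝ} {z : ℂ} (hz : (p : ℂ) * (1 - z / 2) = 1)
    (f : EuclideanSpace ℝ (Fin n) → ℂ) : steinFamily p f z = f := by
  ext x
  by_cases hx : f x = 0
  · simp [steinFamily, hx]
  have h3 : 0 < ‖f x‖ := norm_pos_iff.2 hx
  rw [steinFamily, hz, one_mul, ← Complex.ofReal_exp, Real.exp_log h3]
  exact div_mul_cancel₀ _ (by exact_mod_cast h3.ne')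

theorem IsTame.integrable_rpow {f : EuclideanSpace ℝ (Fin n) → ℂ} (hf : IsTame f) {s : ℝ}
    (hs : 0 < s) : Integrable (fun x => ‖f x‖ ^ s) := by
  obtain ⟨hm, M, hM, h⟩ := hf
  refine integrable_of_bounded_support (B := M ^ s) (M := M)
    (Measurable.aestronglyMeasurable (by fun_prop)) ?_ ?_
  · intro x
    rw [Real.norm_of_nonneg (by positivity)]
    by_cases hx : f x = 0
    · simp [hx, Real.zero_rpow hs.ne']; positivity
    · gcongr
      exact (h x hx).2.2
  · intro x hx
    refine (h x fun h0 => hx ?_).1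
    simp [h0, Real.zero_rpow hs.ne']

theorem IsTame.integrable_steinFamily {f : EuclideanSpace ℝ (Fin n) → ℂ} (hf : IsTame f) {p : ℝ}
    (hp : 0 < p) {z : ℂ} (hz : z.re < 2) : Integrable (steinFamily p f z) := by
  have hs : 0 < p * (1 - z.re / 2) := mul_pos hp (by linarith)
  rw [← integrable_norm_iff (measurable_steinFamily hf.1 p z).aestronglyMeasurable]
  simp_rw [norm_steinFamily hp f hz]
  exact hf.integrable_rpow hs

theorem IsTame.integrable {f : EuclideanSpace ℝ (Fin n) → ℂ} (hf : IsTame f) : Integrable f := by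
  rw [← integrable_norm_iff hf.1.aestronglyMeasurable]
  simpa using hf.integrable_rpow one_pos

theorem IsTame.const_mul {f : EuclideanSpace ℝ (Fin n) → ℂ} (hf : IsTame f) {c : ℂ} (hc : c ≠ 0) :
    IsTame (fun x => c * f x) := by
  obtain ⟨hm, M, hM, h⟩ := hf
  have hc0 : 0 < ‖c‖ := norm_pos_iff.2 hc
  refine ⟨hm.const_mul c, M + ‖c‖ * M + ‖c‖⁻¹ * M, by positivity, fun x hx => ?_⟩
  obtain ⟨h1, h2, h3⟩ := h x (right_ne_zero_of_mul hx)
  have e1 : 0 < ‖c‖ * M := by positivity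
  have e2 : 0 < ‖c‖⁻¹ * M := by positivity
  rw [norm_mul]
  refine ⟨by linarith, ?_, ?_⟩
  · calc (M + ‖c‖ * M + ‖c‖⁻¹ * M)⁻¹ ≤ (‖c‖⁻¹ * M)⁻¹ := by gcongr; linarith
      _ = ‖c‖ * M⁻¹ := by rw [mul_inv, inv_inv]
      _ ≤ ‖c‖ * ‖f x‖ := by gcongr
  · calc ‖c‖ * ‖f x‖ ≤ ‖c‖ * M := by gcongr
      _ ≤ _ := by linarith

end TameFunctions

section Interpolation

variable {n : ℕ} {ν : Measure (EuclideanSpace ℝ (Fin n))} {R : ℝ}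

theorem abs_log_one_add_norm_sub_sq_le {x y : EuclideanSpace ℝ (Fin n)} {M₁ M₂ : ℝ}
    (hx : ‖x‖ ≤ M₁) (hy : ‖y‖ ≤ M₂) :
    |Real.log (1 + ‖x - y‖ ^ 2)| ≤ Real.log (1 + (M₁ + M₂) ^ 2) := by
  rw [abs_of_nonneg (Real.log_nonneg (by nlinarith [sq_nonneg ‖x - y‖]))]
  have h1 : ‖x - y‖ ≤ M₁ + M₂ := (norm_sub_le x y).trans (add_le_add hx hy)
  gcongr

/-- The kernel `μ̂ (x) (1 + |x|²) ^ w` with complex damping exponent `w`. -/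
def dampedKernel (ν : Measure (EuclideanSpace ℝ (Fin n))) (w : ℂ)
    (x : EuclideanSpace ℝ (Fin n)) : ℂ :=
  measureFourier ν x * ((1 + ‖x‖ ^ 2 : ℝ) : ℂ) ^ w

theorem norm_dampedKernel (w : ℂ) (x : EuclideanSpace ℝ (Fin n)) :
    ‖dampedKernel ν w x‖ = ‖measureFourier ν x‖ * (1 + ‖x‖ ^ 2) ^ w.re := by
  rw [dampedKernel, norm_mul, Complex.norm_cpow_eq_rpow_re_of_pos (by positivity)]

/-- The damping exponents, equal to `α / 2` at `0` and to `-1 / 2` at `1`. -/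
def dampingExponent (α : ℝ) (z : ℂ) : ℂ := (α - (α + 1) * z) / 2

theorem convForm_family_analytic [IsFiniteMeasure ν] (α p : ℝ)
    {f g : EuclideanSpace ℝ (Fin n) → ℂ} (hf : IsTame f) (hg : IsTame g) :
    Differentiable ℂ (fun z => convForm (dampedKernel ν (dampingExponent α z))
      (steinFamily p f z) (steinFamily p g z)) ∧
    ∃ B, ∀ z : ℂ, 0 ≤ z.re → z.re ≤ 1 →
      ‖convForm (dampedKernel ν (dampingExponent α z)) (steinFamily p f z) (steinFamily p g z)‖ ≤
        B := by
  obtain ⟨Bf, hBf⟩ := hf.abs_log_le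
  obtain ⟨Bg, hBg⟩ := hg.abs_log_le
  have hf' := hf
  have hg' := hg
  obtain ⟨hfm, M₁, hM₁, h₁⟩ := hf
  obtain ⟨hgm, M₂, hM₂, h₂⟩ := hg
  set ld : EuclideanSpace ℝ (Fin n) × EuclideanSpace ℝ (Fin n) → ℝ :=
    fun q => Real.log (1 + ‖q.1 - q.2‖ ^ 2) with hld
  set lf : EuclideanSpace ℝ (Fin n) × EuclideanSpace ℝ (Fin n) → ℝ :=
    fun q => Real.log ‖f q.2‖ + Real.log ‖g q.1‖ with hlf
  set a : EuclideanSpace ℝ (Fin n) × EuclideanSpace ℝ (Fin n) → ℂ :=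
    fun q => measureFourier ν (q.1 - q.2) * ((g q.1 / ‖g q.1‖) * (f q.2 / ‖f q.2‖)) with ha
  set b : EuclideanSpace ℝ (Fin n) × EuclideanSpace ℝ (Fin n) → ℝ :=
    fun q => α / 2 * ld q + p * lf q with hb
  set c : EuclideanSpace ℝ (Fin n) × EuclideanSpace ℝ (Fin n) → ℝ :=
    fun q => -((α + 1) / 2) * ld q + -(p / 2) * lf q with hc
  have hldm : Measurable ld := by fun_prop
  have hlfm : Measurable lf := by fun_prop
  have hsgn : ∀ {h : EuclideanSpace ℝ (Fin n) → ℂ}, IsTame h →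
      Integrable (fun x => h x / ‖h x‖) := by
    rintro h ⟨hm, M, hM, hh⟩
    refine integrable_of_bounded_support (B := 1) (M := M)
      (Measurable.aestronglyMeasurable (by fun_prop)) ?_ ?_
    · intro x
      rw [norm_div, Complex.norm_real, norm_norm]
      exact div_self_le_one _
    · intro x hx
      exact (hh x fun h0 => hx (by simp [h0])).1
  have haint : Integrable a := by
    refine ((hsgn hg').mul_prod (hsgn hf')).bdd_mul (c := ν.real Set.univ)
      (Continuous.aestronglyMeasurable (continuous_measureFourier.comp (by fun_prop)))
      (Filter.Eventually.of_forall fun q => norm_measureFourier_le _)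
  set D := Real.log (1 + (M₂ + M₁) ^ 2) with hD
  have hfg : ∀ q, a q ≠ 0 → |ld q| ≤ D ∧ |lf q| ≤ Bf + Bg := by
    intro q hq
    have hq2 := right_ne_zero_of_mul hq
    have hg0 : g q.1 ≠ 0 := fun h0 => left_ne_zero_of_mul hq2 (by simp [h0])
    have hf0 : f q.2 ≠ 0 := fun h0 => right_ne_zero_of_mul hq2 (by simp [h0])
    exact ⟨abs_log_one_add_norm_sub_sq_le (h₂ _ hg0).1 (h₁ _ hf0).1,
      (abs_add_le _ _).trans (add_le_add (hBf _) (hBg _))⟩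
  have hlin : ∀ (s t : ℝ) q, a q ≠ 0 → |s * ld q + t * lf q| ≤ |s| * D + |t| * (Bf + Bg) := by
    intro s t q hq
    refine (abs_add_le _ _).trans ?_
    rw [abs_mul, abs_mul]
    have := hfg q hq
    exact add_le_add (mul_le_mul_of_nonneg_left this.1 (abs_nonneg _))
      (mul_le_mul_of_nonneg_left this.2 (abs_nonneg _))
  set B₀ := max (|α / 2| * D + |p| * (Bf + Bg))
    (|-((α + 1) / 2)| * D + |-(p / 2)| * (Bf + Bg)) with hB₀
  have hbB : ∀ q, a q ≠ 0 → |b q| ≤ B₀ := fun q hq => (hlin _ _ q hq).trans (le_max_left _ _)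
  have hcB : ∀ q, a q ≠ 0 → |c q| ≤ B₀ := fun q hq => (hlin _ _ q hq).trans (le_max_right _ _)
  have hrepr : ∀ z : ℂ, convForm (dampedKernel ν (dampingExponent α z)) (steinFamily p f z)
      (steinFamily p g z) = ∫ q, a q * Complex.exp (b q + z * c q) := by
    intro z
    rw [convForm]
    congr 1
    ext q
    have hpos : 0 < 1 + ‖q.1 - q.2‖ ^ 2 := by positivity
    have hne : ((1 + ‖q.1 - q.2‖ ^ 2 : ℝ) : ℂ) ≠ 0 := by exact_mod_cast hpos.ne'
    rw [dampedKernel, Complex.cpow_def_of_ne_zero hne, ← Complex.ofReal_log hpos.le, steinFamily,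
      steinFamily]
    have hexp : Complex.exp (b q + z * c q) =
        Complex.exp ((Real.log (1 + ‖q.1 - q.2‖ ^ 2) : ℝ) * dampingExponent α z) *
        Complex.exp (p * (1 - z / 2) * Real.log ‖f q.2‖) *
        Complex.exp (p * (1 - z / 2) * Real.log ‖g q.1‖) := by
      rw [← Complex.exp_add, ← Complex.exp_add]
      congr 1
      simp only [hb, hc, hld, hlf, dampingExponent]
      push_cast
      ring
    rw [hexp]
    simp only [ha]
    ring
  simp_rw [hrepr]
  refine ⟨differentiable_integral_exp_family haint (by fun_prop) (by fun_prop) hbB hcB, _,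
    fun z hz0 hz1 => norm_integral_exp_family_le haint hbB hcB hz0 hz1⟩

theorem norm_convForm_dampedKernel_le [IsFiniteMeasure ν] {w : ℂ} {C : ℝ}
    (hC : ∀ x, ‖dampedKernel ν w x‖ ≤ C) {f g : EuclideanSpace ℝ (Fin n) → ℂ}
    (hf : Integrable f) (hg : Integrable g) :
    ‖convForm (dampedKernel ν w) f g‖ ≤ C * ((∫ x, ‖f x‖) * ∫ x, ‖g x‖) := by
  have h1 : Integrable (fun q : EuclideanSpace ℝ (Fin n) × EuclideanSpace ℝ (Fin n) =>
      ‖g q.1‖ * ‖f q.2‖) := hg.norm.mul_prod hf.norm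
  calc _ ≤ ∫ q : EuclideanSpace ℝ (Fin n) × EuclideanSpace ℝ (Fin n),
        C * (‖g q.1‖ * ‖f q.2‖) := by
        refine norm_integral_le_of_norm_le (h1.const_mul C)
          (Filter.Eventually.of_forall fun q => ?_)
        rw [mul_assoc, norm_mul, norm_mul, mul_comm ‖f q.2‖]
        exact mul_le_mul_of_nonneg_right (hC _) (by positivity)
    _ = _ := by
        rw [integral_const_mul]
        congr 1
        rw [mul_comm]
        exact integral_prod_mul (fun x => ‖g x‖) (fun x => ‖f x‖)

theorem exists_norm_convForm_le_of_integral_eq_one [IsFiniteMeasure ν] (hν : IsSpherical ν R)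
    (hR : 0 < R) (hn : 1 ≤ n) {p : ℝ} (hp1 : 1 < p) (hp2 : p < 2)
    (hp3 : p * (n + 3) ≤ 2 * n + 2) :
    ∃ C, 0 ≤ C ∧ ∀ f g : EuclideanSpace ℝ (Fin n) → ℂ, IsTame f → IsTame g →
      ∫ x, ‖f x‖ ^ p = 1 → ∫ x, ‖g x‖ ^ p = 1 → ‖convForm (measureFourier ν) f g‖ ≤ C := by
  obtain ⟨C₀, hC₀0, hC₀⟩ := hν.exists_norm_integral_exp_le hR hn
  obtain ⟨C₁, hC₁0, hC₁⟩ := exists_norm_convForm_damped_le hν hR hn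
  have hp0 : 0 < p := by linarith
  set θ : ℝ := 2 - 2 / p with hθ
  have hθ0 : 0 < θ := by
    rw [hθ, sub_pos, div_lt_iff₀ hp0]; linarith
  have hθ1 : θ < 1 := by
    have : 1 < 2 / p := by rw [lt_div_iff₀ hp0]; linarith
    linarith
  set α : ℝ := (2 * p - 2) / (2 - p) with hα
  have hα0 : 0 ≤ α := div_nonneg (by linarith) (by linarith)
  have hα1 : α / 2 ≤ ((n : ℝ) - 1) / 4 := by
    have : α ≤ ((n : ℝ) - 1) / 2 := by
      rw [hα, div_le_iff₀ (by linarith)]; nlinarith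
    linarith
  have hαθ : α - (α + 1) * θ = 0 := by
    have h2p : (2 - p) ≠ 0 := by linarith
    rw [hα, hθ]; field_simp; ring
  set A : ℝ := Real.exp 1 * C₀ with hA
  set K : ℝ := Real.pi * (α + 1) / 4 with hK
  set B : ℝ := Real.exp (1 + K ^ 2) * (2 * C₁ / (α + 1)) with hB
  refine ⟨A ^ (1 - θ) * B ^ θ / ‖(1 - θ : ℂ) * Complex.exp ((θ : ℂ) ^ 2)‖, by positivity,
    fun f g hf hg hf1 hg1 => ?_⟩
  set F : ℂ → ℂ := fun z => ((1 - z) * Complex.exp (z ^ 2)) *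
    convForm (dampedKernel ν (dampingExponent α z)) (steinFamily p f z) (steinFamily p g z) with hF
  obtain ⟨hdiff, B', hB'⟩ := convForm_family_analytic (ν := ν) α p hf hg
  have hFd : Differentiable ℂ F := by
    refine Differentiable.mul ?_ hdiff
    fun_prop
  have hθmem : (θ : ℂ) ∈ Complex.HadamardThreeLines.verticalClosedStrip 0 1 := by
    simp only [Complex.HadamardThreeLines.verticalClosedStrip, Set.mem_preimage, Complex.ofReal_re,
      Set.mem_Icc]
    exact ⟨hθ0.le, hθ1.le⟩
  have hleft : ∀ z ∈ Complex.re ⁻¹' {(0 : ℝ)}, ‖F z‖ ≤ A := by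
    intro z hz
    have hz0 : z.re = 0 := hz
    have hker : ∀ x, ‖dampedKernel ν (dampingExponent α z) x‖ ≤ C₀ := by
      intro x
      refine le_trans ?_ (hC₀ x)
      rw [norm_dampedKernel, mul_comm]
      refine mul_le_mul_of_nonneg_right ?_ (norm_nonneg _)
      have hre : (dampingExponent α z).re = α / 2 := by
        have : dampingExponent α z = ((1 / 2 : ℝ) : ℂ) * (α - ((α + 1 : ℝ) : ℂ) * z) := by
          rw [dampingExponent]; push_cast; ring
        rw [this, Complex.re_ofReal_mul, Complex.sub_re, Complex.re_ofReal_mul, hz0,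
          Complex.ofReal_re]
        ring
      rw [hre]
      exact Real.rpow_le_rpow_of_exponent_le (by nlinarith [sq_nonneg ‖x‖]) hα1
    have hz2 : z.re < 2 := by rw [hz0]; norm_num
    have h1 := norm_convForm_dampedKernel_le hker (hf.integrable_steinFamily hp0 hz2)
      (hg.integrable_steinFamily hp0 hz2)
    simp_rw [norm_steinFamily hp0 _ hz2, hz0] at h1
    norm_num at h1
    rw [hf1, hg1, one_mul, mul_one] at h1
    rw [hF]
    simp only
    rw [norm_mul]
    exact mul_le_mul (norm_one_sub_mul_exp_sq_le hz0.ge (by rw [hz0]; norm_num)) h1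
      (norm_nonneg _) (Real.exp_pos _).le
  have hright : ∀ z ∈ Complex.re ⁻¹' {(1 : ℝ)}, ‖F z‖ ≤ B := by
    intro z hz
    have hz1 : z.re = 1 := hz
    set t := z.im with ht
    have hzt : z = 1 + Complex.I * t := by
      apply Complex.ext <;> simp [hz1, ht]
    by_cases ht0 : t = 0
    · have : z = 1 := by rw [hzt, ht0]; simp
      simp only [hF, this, sub_self, zero_mul, norm_zero]
      positivity
    set η : ℝ := (α + 1) * t / 2 with hη
    have hη0 : η ≠ 0 := by
      have : α + 1 ≠ 0 := by linarith
      positivity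
    have hz2 : z.re < 2 := by rw [hz1]; norm_num
    have hsq : ∀ {h : EuclideanSpace ℝ (Fin n) → ℂ} (x : EuclideanSpace ℝ (Fin n)),
        ‖steinFamily p h z x‖ ^ 2 = ‖h x‖ ^ p := by
      intro h x
      rw [norm_steinFamily hp0 h hz2, hz1, ← Real.rpow_natCast, ← Real.rpow_mul (norm_nonneg _)]
      congr 1; push_cast; ring
    have h1 := hC₁ η (steinFamily p f z) (steinFamily p g z) hη0
      (hf.integrable_steinFamily hp0 hz2)
      (by simp_rw [hsq]; exact hf.integrable_rpow hp0) (hg.integrable_steinFamily hp0 hz2)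
      (by simp_rw [hsq]; exact hg.integrable_rpow hp0)
    simp_rw [hsq] at h1
    rw [hf1, hg1] at h1
    have hexp : dampingExponent α z = -(1 / 2 + Complex.I * η) := by
      rw [dampingExponent, hzt, hη]; push_cast; ring
    have hFz : ‖F z‖ = |t| * Real.exp (1 - t ^ 2) *
        ‖convForm (dampedKernel ν (-(1 / 2 + Complex.I * η))) (steinFamily p f z)
          (steinFamily p g z)‖ := by
      simp only [hF, hexp, norm_mul, Complex.norm_exp]
      congr 2
      · rw [hzt]; simp
      · simp [sq, Complex.mul_re, hz1, ← ht]
    rw [hFz]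
    set Q := ‖convForm (dampedKernel ν (-(1 / 2 + Complex.I * η))) (steinFamily p f z)
          (steinFamily p g z)‖ with hQ
    have h2 : Real.exp (-(Real.pi * |η| / 2)) * Q ≤ C₁ / |η| := by
      refine (mul_le_mul_of_nonneg_right (exp_le_norm_Gamma_half η) (norm_nonneg _)).trans ?_
      refine h1.trans (le_of_eq ?_)
      ring
    have hηabs : |η| = (α + 1) * |t| / 2 := by
      rw [hη, abs_div, abs_mul, abs_of_pos (by linarith : (0:ℝ) < α + 1), abs_two]
    have h3 : Q ≤ C₁ / |η| * Real.exp (K * |t|) := by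
      have : Real.exp (K * |t|) = (Real.exp (-(Real.pi * |η| / 2)))⁻¹ := by
        rw [← Real.exp_neg, hηabs, hK]; congr 1; ring
      rw [this, ← div_eq_mul_inv, le_div_iff₀ (Real.exp_pos _), mul_comm]
      exact h2
    have htpos : 0 < |t| := abs_pos.2 ht0
    calc |t| * Real.exp (1 - t ^ 2) * Q
        ≤ |t| * Real.exp (1 - t ^ 2) * (C₁ / |η| * Real.exp (K * |t|)) := by gcongr
      _ = Real.exp (1 - t ^ 2 + K * |t|) * (2 * C₁ / (α + 1)) := by
          rw [Real.exp_add, hηabs]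
          have : α + 1 ≠ 0 := by linarith
          field_simp
      _ ≤ B := by
          refine mul_le_mul_of_nonneg_right (Real.exp_le_exp.2 ?_) (by positivity)
          rw [← sq_abs t]
          nlinarith [sq_nonneg (K - 2 * |t|), sq_nonneg K, sq_nonneg |t|]
  have hbdd : BddAbove ((norm ∘ F) '' Complex.HadamardThreeLines.verticalClosedStrip 0 1) := by
    refine ⟨Real.exp 1 * B', ?_⟩
    rintro _ ⟨z, hz, rfl⟩
    have hz' : 0 ≤ z.re ∧ z.re ≤ 1 := hz
    simp only [Function.comp, hF, norm_mul]
    rw [← norm_mul]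
    exact mul_le_mul (norm_one_sub_mul_exp_sq_le hz'.1 hz'.2) (hB' z hz'.1 hz'.2)
      (norm_nonneg _) (Real.exp_pos _).le
  have h3 := Complex.HadamardThreeLines.norm_le_interp_of_mem_verticalClosedStrip₀₁' F hθmem
    hFd.diffContOnCl hbdd hleft hright
  have hθself : (p : ℂ) * (1 - (θ : ℂ) / 2) = 1 := by
    have : p * (1 - θ / 2) = 1 := by rw [hθ]; field_simp; ring
    exact_mod_cast this
  have hθk : dampedKernel ν (dampingExponent α θ) = measureFourier ν := by
    have : dampingExponent α (θ : ℂ) = 0 := by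
      have h4 : ((α - (α + 1) * θ : ℝ) : ℂ) = 0 := by rw [hαθ]; simp
      push_cast at h4
      rw [dampingExponent, h4, zero_div]
    ext x
    rw [dampedKernel, this, Complex.cpow_zero, mul_one]
  simp only [hF, hθk, steinFamily_eq_self hθself, Complex.ofReal_re] at h3
  have hne : 0 < ‖(1 - θ : ℂ) * Complex.exp ((θ : ℂ) ^ 2)‖ := by
    rw [norm_pos_iff]
    refine mul_ne_zero ?_ (Complex.exp_ne_zero _)
    have : (1 - θ : ℝ) ≠ 0 := by linarith
    exact_mod_cast this
  rw [le_div_iff₀ hne, mul_comm, ← norm_mul]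
  exact h3

end Interpolation

section Convolution

variable {n : ℕ} {ν : Measure (EuclideanSpace ℝ (Fin n))} {R : ℝ}

theorem IsTame.memLp {f : EuclideanSpace ℝ (Fin n) → ℂ} (hf : IsTame f) {q : ℝ≥0∞} (hq0 : q ≠ 0)
    (hq : q ≠ ∞) : MemLp f q :=
  (integrable_norm_rpow_iff hf.1.aestronglyMeasurable hq0 hq).1
    (hf.integrable_rpow (ENNReal.toReal_pos hq0 hq))

theorem norm_convForm_measureFourier_le [IsFiniteMeasure ν]
    {f g : EuclideanSpace ℝ (Fin n) → ℂ} (hf : Integrable f) (hg : Integrable g) :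
    ‖convForm (measureFourier ν) f g‖ ≤ ν.real Set.univ * ((∫ x, ‖f x‖) * ∫ x, ‖g x‖) := by
  have h0 : dampedKernel ν 0 = measureFourier ν := by
    ext x; simp [dampedKernel]
  have := norm_convForm_dampedKernel_le (ν := ν) (w := 0) (C := ν.real Set.univ)
    (fun x => by rw [h0]; exact norm_measureFourier_le x) hf hg
  rwa [h0] at this

theorem integral_norm_eq_zero_of_rpow {f : EuclideanSpace ℝ (Fin n) → ℂ} (hf : IsTame f) {p : ℝ}
    (hp : 0 < p) (h : ∫ x, ‖f x‖ ^ p = 0) : ∫ x, ‖f x‖ = 0 := by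
  rw [integral_eq_zero_iff_of_nonneg (fun x => by positivity) (hf.integrable_rpow hp)] at h
  refine integral_eq_zero_of_ae ?_
  filter_upwards [h] with x hx
  exact (Real.rpow_eq_zero (norm_nonneg _) hp.ne').1 hx

theorem exists_norm_convForm_le [IsFiniteMeasure ν] (hν : IsSpherical ν R)
    (hR : 0 < R) (hn : 1 ≤ n) {p : ℝ} (hp1 : 1 < p) (hp2 : p < 2)
    (hp3 : p * (n + 3) ≤ 2 * n + 2) :
    ∃ C, 0 ≤ C ∧ ∀ f g : EuclideanSpace ℝ (Fin n) → ℂ, IsTame f → IsTame g →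
      ‖convForm (measureFourier ν) f g‖ ≤
        C * (∫ x, ‖f x‖ ^ p) ^ p⁻¹ * (∫ x, ‖g x‖ ^ p) ^ p⁻¹ := by
  obtain ⟨C, hC0, hC⟩ := exists_norm_convForm_le_of_integral_eq_one hν hR hn hp1 hp2 hp3
  refine ⟨C, hC0, fun f g hf hg => ?_⟩
  have hp0 : 0 < p := by linarith
  have hnn : ∀ h : EuclideanSpace ℝ (Fin n) → ℂ, 0 ≤ ∫ x, ‖h x‖ ^ p :=
    fun h => integral_nonneg fun x => by positivity
  have hrhs : 0 ≤ C * (∫ x, ‖f x‖ ^ p) ^ p⁻¹ * (∫ x, ‖g x‖ ^ p) ^ p⁻¹ :=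
    mul_nonneg (mul_nonneg hC0 (Real.rpow_nonneg (hnn f) _)) (Real.rpow_nonneg (hnn g) _)
  have htriv := norm_convForm_measureFourier_le (ν := ν) hf.integrable hg.integrable
  rcases (hnn f).eq_or_lt with hF | hF
  · rw [integral_norm_eq_zero_of_rpow hf hp0 hF.symm, zero_mul, mul_zero] at htriv
    exact htriv.trans hrhs
  rcases (hnn g).eq_or_lt with hG | hG
  · rw [integral_norm_eq_zero_of_rpow hg hp0 hG.symm, mul_zero, mul_zero] at htriv
    exact htriv.trans hrhs
  set a := (∫ x, ‖f x‖ ^ p) ^ p⁻¹ with ha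
  set b := (∫ x, ‖g x‖ ^ p) ^ p⁻¹ with hb
  have ha0 : 0 < a := Real.rpow_pos_of_pos hF _
  have hb0 : 0 < b := Real.rpow_pos_of_pos hG _
  have hnorm : ∀ (h : EuclideanSpace ℝ (Fin n) → ℂ) (c : ℝ), 0 < c →
      (∫ x, ‖h x‖ ^ p) ^ p⁻¹ = c → 0 < ∫ x, ‖h x‖ ^ p →
      ∫ x, ‖((c⁻¹ : ℝ) : ℂ) * h x‖ ^ p = 1 := by
    intro h c hc hcc hpos
    have : ∀ x, ‖((c⁻¹ : ℝ) : ℂ) * h x‖ ^ p = (c⁻¹) ^ p * ‖h x‖ ^ p := fun x => by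
      rw [norm_mul, Complex.norm_real, Real.norm_of_nonneg (by positivity),
        Real.mul_rpow (by positivity) (by positivity)]
    simp_rw [this]
    rw [integral_const_mul, Real.inv_rpow hc.le, ← hcc, ← Real.rpow_mul hpos.le,
      inv_mul_cancel₀ hp0.ne', Real.rpow_one, inv_mul_cancel₀ hpos.ne']
  have hne : ∀ {c : ℝ}, 0 < c → ((c⁻¹ : ℝ) : ℂ) ≠ 0 := fun hc => by
    exact_mod_cast (inv_pos.2 hc).ne'
  have key := hC _ _ (hf.const_mul (hne ha0)) (hg.const_mul (hne hb0))
    (hnorm f a ha0 rfl hF) (hnorm g b hb0 rfl hG)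
  have hscale : convForm (measureFourier ν) (fun x => ((a⁻¹ : ℝ) : ℂ) * f x)
      (fun x => ((b⁻¹ : ℝ) : ℂ) * g x) =
      ((a⁻¹ * b⁻¹ : ℝ) : ℂ) * convForm (measureFourier ν) f g := by
    rw [convForm, convForm, ← integral_const_mul]
    congr 1; ext q; push_cast; ring
  rw [hscale, norm_mul, Complex.norm_real, Real.norm_of_nonneg (by positivity), ← mul_inv,
    inv_mul_le_iff₀ (by positivity)] at key
  linarith

theorem integrable_measureFourier_sub_mul [IsFiniteMeasure ν]
    {f : EuclideanSpace ℝ (Fin n) → ℂ} (hf : Integrable f) (x : EuclideanSpace ℝ (Fin n)) :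
    Integrable (fun y => measureFourier ν (x - y) * f y) :=
  hf.bdd_mul (c := ν.real Set.univ)
    (Continuous.aestronglyMeasurable (continuous_measureFourier.comp (by fun_prop)))
    (Filter.Eventually.of_forall fun _ => norm_measureFourier_le _)

theorem norm_integral_measureFourier_le [IsFiniteMeasure ν]
    {f : EuclideanSpace ℝ (Fin n) → ℂ} (hf : Integrable f) (x : EuclideanSpace ℝ (Fin n)) :
    ‖∫ y, measureFourier ν (x - y) * f y‖ ≤ ν.real Set.univ * ∫ y, ‖f y‖ := by
  rw [← integral_const_mul]
  refine norm_integral_le_of_norm_le (hf.norm.const_mul _) (Filter.Eventually.of_forall fun y => ?_)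
  rw [norm_mul]
  exact mul_le_mul_of_nonneg_right (norm_measureFourier_le _) (norm_nonneg _)

theorem continuous_integral_measureFourier [IsFiniteMeasure ν]
    {f : EuclideanSpace ℝ (Fin n) → ℂ} (hf : Integrable f) :
    Continuous (fun x => ∫ y, measureFourier ν (x - y) * f y) := by
  refine continuous_of_dominated (bound := fun y => ν.real Set.univ * ‖f y‖)
    (fun x => (integrable_measureFourier_sub_mul hf x).1) (fun x => ?_) (hf.norm.const_mul _) ?_
  · refine Filter.Eventually.of_forall fun y => ?_
    rw [norm_mul]
    exact mul_le_mul_of_nonneg_right (norm_measureFourier_le _) (norm_nonneg _)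
  · exact Filter.Eventually.of_forall fun y =>
      (continuous_measureFourier.comp (by fun_prop)).mul continuous_const

theorem convForm_measureFourier_eq [IsFiniteMeasure ν]
    {f g : EuclideanSpace ℝ (Fin n) → ℂ} (hf : Integrable f) (hg : Integrable g) :
    convForm (measureFourier ν) f g =
      ∫ x, (∫ y, measureFourier ν (x - y) * f y) * g x := by
  have hint : Integrable (fun q : EuclideanSpace ℝ (Fin n) × EuclideanSpace ℝ (Fin n) =>
      measureFourier ν (q.1 - q.2) * f q.2 * g q.1) := by
    refine ((hg.mul_prod hf).bdd_mul (c := ν.real Set.univ)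
      (f := fun q : EuclideanSpace ℝ (Fin n) × EuclideanSpace ℝ (Fin n) =>
        measureFourier ν (q.1 - q.2))
      (Continuous.aestronglyMeasurable (continuous_measureFourier.comp (by fun_prop)))
      (Filter.Eventually.of_forall fun q => norm_measureFourier_le _)).congr
      (Filter.Eventually.of_forall fun q => ?_)
    simp only
    ring
  rw [convForm]
  refine (integral_prod _ hint).trans ?_
  congr 1; ext x
  exact integral_mul_const (g x) (fun y => measureFourier ν (x - y) * f y)

/-- Truncation of a function both in space and in values. -/
def truncate (f : EuclideanSpace ℝ (Fin n) → ℂ) (N : ℕ) : EuclideanSpace ℝ (Fin n) → ℂ :=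
  {x | ‖x‖ ≤ N + 1 ∧ ((N : ℝ) + 1)⁻¹ ≤ ‖f x‖ ∧ ‖f x‖ ≤ N + 1}.indicator f

theorem isTame_truncate {f : EuclideanSpace ℝ (Fin n) → ℂ} (hf : Measurable f) (N : ℕ) :
    IsTame (truncate f N) := by
  refine ⟨hf.indicator ?_, N + 1, by positivity, fun x hx => ?_⟩
  · exact (measurableSet_le measurable_norm measurable_const).inter
      ((measurableSet_le measurable_const hf.norm).inter
        (measurableSet_le hf.norm measurable_const))
  · rw [truncate] at hx ⊢
    have hm := Set.mem_of_indicator_ne_zero hx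
    rwa [Set.indicator_of_mem hm]

theorem norm_truncate_le (f : EuclideanSpace ℝ (Fin n) → ℂ) (N : ℕ)
    (x : EuclideanSpace ℝ (Fin n)) : ‖truncate f N x‖ ≤ ‖f x‖ :=
  norm_indicator_le_norm_self _ _

theorem truncate_eq_zero_or_eq (f : EuclideanSpace ℝ (Fin n) → ℂ) (N : ℕ)
    (x : EuclideanSpace ℝ (Fin n)) : truncate f N x = 0 ∨ truncate f N x = f x :=
  Set.indicator_eq_zero_or_self _ _ _

theorem tendsto_truncate (f : EuclideanSpace ℝ (Fin n) → ℂ) (x : EuclideanSpace ℝ (Fin n)) :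
    Filter.Tendsto (fun N => truncate f N x) Filter.atTop (nhds (f x)) := by
  by_cases hx : f x = 0
  · refine tendsto_const_nhds.congr fun N => ?_
    rcases truncate_eq_zero_or_eq f N x with h | h
    · rw [h, hx]
    · rw [h]
  have h3 : 0 < ‖f x‖ := norm_pos_iff.2 hx
  refine tendsto_const_nhds.congr' ?_
  have e0 : Filter.Tendsto (fun N : ℕ => (N : ℝ) + 1) Filter.atTop Filter.atTop :=
    Filter.tendsto_atTop_add_const_right _ _ tendsto_natCast_atTop_atTop
  filter_upwards [e0.eventually_ge_atTop ‖x‖, e0.eventually_ge_atTop ‖f x‖,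
    e0.eventually_ge_atTop ‖f x‖⁻¹] with N h1 h2 h4
  have h5 : ((N : ℝ) + 1)⁻¹ ≤ ‖f x‖ := inv_le_of_inv_le₀ h3 h4
  rw [truncate, Set.indicator_of_mem]
  exact ⟨h1, h5, h2⟩

theorem eLpNorm_le_of_tendsto {F : ℕ → EuclideanSpace ℝ (Fin n) → ℂ}
    {G : EuclideanSpace ℝ (Fin n) → ℂ} {q B : ℝ≥0∞} (hF : ∀ N, AEStronglyMeasurable (F N))
    (hlim : ∀ x, Filter.Tendsto (fun N => F N x) Filter.atTop (nhds (G x)))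
    (hB : ∀ N, eLpNorm (F N) q ≤ B) : eLpNorm G q ≤ B := by
  refine (Lp.eLpNorm_lim_le_liminf_eLpNorm hF G (Filter.Eventually.of_forall hlim)).trans ?_
  exact (Filter.liminf_le_liminf (Filter.Eventually.of_forall hB)).trans (by simp)

/-- The converse to Hölder's inequality, by truncation of the extremal function. -/
theorem eLpNorm_le_of_dual {p q : ℝ} (hpq : p.HolderConjugate q)
    {h : EuclideanSpace ℝ (Fin n) → ℂ} (hm : Measurable h) {D : ℝ} (hD : 0 ≤ D)
    (hdual : ∀ g, IsTame g → ‖∫ x, h x * g x‖ ≤ D * (∫ x, ‖g x‖ ^ p) ^ p⁻¹) :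
    eLpNorm h (ENNReal.ofReal q) ≤ ENNReal.ofReal D := by
  have hp := hpq.pos
  have hq := hpq.symm.pos
  refine eLpNorm_le_of_tendsto (F := truncate h)
    (fun N => (isTame_truncate hm N).1.aestronglyMeasurable) (tendsto_truncate h) fun N => ?_
  set u := truncate h N with hu
  have hut : IsTame u := isTame_truncate hm N
  have hq0 : ENNReal.ofReal q ≠ 0 := by simpa using hq
  rw [MemLp.eLpNorm_eq_integral_rpow_norm hq0 ENNReal.ofReal_ne_top
    (hut.memLp hq0 ENNReal.ofReal_ne_top), ENNReal.toReal_ofReal hq.le]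
  refine ENNReal.ofReal_le_ofReal ?_
  set I := ∫ x, ‖u x‖ ^ q with hI
  have hI0 : 0 ≤ I := integral_nonneg fun x => by positivity
  rcases hI0.eq_or_lt with hIz | hIpos
  · rw [← hIz, Real.zero_rpow (inv_ne_zero hq.ne')]
    exact hD
  set g : EuclideanSpace ℝ (Fin n) → ℂ :=
    fun x => ((‖u x‖ ^ (q - 2) : ℝ) : ℂ) * starRingEnd ℂ (u x) with hg
  have hgn : ∀ x, u x ≠ 0 → ‖g x‖ = ‖u x‖ ^ (q - 1) := by
    intro x hx
    have hx0 : 0 < ‖u x‖ := norm_pos_iff.2 hx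
    rw [hg]
    simp only
    rw [norm_mul, Complex.norm_real, Real.norm_of_nonneg (by positivity), RCLike.norm_conj]
    conv_lhs => rw [← Real.rpow_one ‖u x‖, ← Real.rpow_mul hx0.le, ← Real.rpow_add hx0]
    congr 1; ring
  have hgp : ∀ x, ‖g x‖ ^ p = ‖u x‖ ^ q := by
    intro x
    by_cases hx : u x = 0
    · simp [hg, hx, Real.zero_rpow hp.ne', Real.zero_rpow hq.ne']
    · rw [hgn x hx, ← Real.rpow_mul (norm_nonneg _), hpq.symm.sub_one_mul_conj]
  have hgh : ∀ x, h x * g x = ((‖u x‖ ^ q : ℝ) : ℂ) := by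
    intro x
    by_cases hx : u x = 0
    · simp [hg, hx, Real.zero_rpow hq.ne']
    · have hx0 : 0 < ‖u x‖ := norm_pos_iff.2 hx
      have hux : u x = h x := (truncate_eq_zero_or_eq h N x).resolve_left hx
      rw [← hux, hg]
      simp only
      rw [mul_left_comm, Complex.mul_conj, Complex.normSq_eq_norm_sq, ← Complex.ofReal_mul]
      congr 1
      rw [← Real.rpow_natCast, ← Real.rpow_add hx0]
      congr 1; push_cast; ring
  have hgt : IsTame g := by
    obtain ⟨hum, M, hM, hh⟩ := hut
    refine ⟨by fun_prop, M + M ^ (q - 1) + 1, by positivity, fun x hx => ?_⟩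
    have hx0 : u x ≠ 0 := fun h0 => hx (by simp [hg, h0])
    obtain ⟨h1, h2, h3⟩ := hh x hx0
    have hq1 : 0 ≤ q - 1 := by linarith [hpq.symm.lt]
    have hMq : 0 < M ^ (q - 1) := by positivity
    rw [hgn x hx0]
    refine ⟨by linarith, ?_, ?_⟩
    · calc (M + M ^ (q - 1) + 1)⁻¹ ≤ (M ^ (q - 1))⁻¹ := by gcongr; linarith
        _ = (M⁻¹) ^ (q - 1) := (Real.inv_rpow hM.le _).symm
        _ ≤ _ := by gcongr
    · calc ‖u x‖ ^ (q - 1) ≤ M ^ (q - 1) := by gcongr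
        _ ≤ _ := by linarith
  have key := hdual g hgt
  simp_rw [hgh, hgp] at key
  rw [integral_complex_ofReal, Complex.norm_real, Real.norm_of_nonneg hI0] at key
  have hsplit : I = I ^ q⁻¹ * I ^ p⁻¹ := by
    rw [← Real.rpow_add hIpos, add_comm, hpq.inv_add_inv_eq_one, Real.rpow_one]
  have hIp : 0 < I ^ p⁻¹ := Real.rpow_pos_of_pos hIpos _
  refine le_of_mul_le_mul_right ?_ hIp
  rw [← hsplit]
  exact key

theorem exists_eLpNorm_integral_measureFourier_le [IsFiniteMeasure ν] (hν : IsSpherical ν R)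
    (hR : 0 < R) (hn : 1 ≤ n) {p q : ℝ} (hpq : p.HolderConjugate q)
    (hp2 : p < 2) (hp3 : p * (n + 3) ≤ 2 * n + 2) :
    ∃ C, 0 ≤ C ∧ ∀ f : EuclideanSpace ℝ (Fin n) → ℂ, Measurable f → Integrable f →
      MemLp f (ENNReal.ofReal p) →
      eLpNorm (fun x => ∫ y, measureFourier ν (x - y) * f y) (ENNReal.ofReal q) ≤
        ENNReal.ofReal C * eLpNorm f (ENNReal.ofReal p) := by
  obtain ⟨C, hC0, hC⟩ := exists_norm_convForm_le hν hR hn hpq.lt hp2 hp3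
  refine ⟨C, hC0, fun f hfm hf hfp => ?_⟩
  have hp := hpq.pos
  have hp0 : ENNReal.ofReal p ≠ 0 := by simpa using hp
  have hti : ∀ N, Integrable (truncate f N) := fun N => (isTame_truncate hfm N).integrable
  refine eLpNorm_le_of_tendsto (F := fun N x => ∫ y, measureFourier ν (x - y) * truncate f N y)
    (fun N => (continuous_integral_measureFourier (hti N)).aestronglyMeasurable) ?_ fun N => ?_
  · intro x
    refine tendsto_integral_of_dominated_convergence (fun y => ν.real Set.univ * ‖f y‖)
      (fun N => (integrable_measureFourier_sub_mul (hti N) x).1) (hf.norm.const_mul _) ?_ ?_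
    · intro N
      refine Filter.Eventually.of_forall fun y => ?_
      rw [norm_mul]
      exact mul_le_mul (norm_measureFourier_le _) (norm_truncate_le f N y) (norm_nonneg _)
        measureReal_nonneg
    · exact Filter.Eventually.of_forall fun y => (tendsto_truncate f y).const_mul _
  · have hN := isTame_truncate hfm N
    have hnn : 0 ≤ ∫ x, ‖truncate f N x‖ ^ p := integral_nonneg fun x => by positivity
    have h1 : eLpNorm (truncate f N) (ENNReal.ofReal p) =
        ENNReal.ofReal ((∫ x, ‖truncate f N x‖ ^ p) ^ p⁻¹) := by
      rw [MemLp.eLpNorm_eq_integral_rpow_norm hp0 ENNReal.ofReal_ne_top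
        (hN.memLp hp0 ENNReal.ofReal_ne_top), ENNReal.toReal_ofReal hp.le]
    calc _ ≤ ENNReal.ofReal (C * (∫ x, ‖truncate f N x‖ ^ p) ^ p⁻¹) := by
          refine eLpNorm_le_of_dual hpq
            (continuous_integral_measureFourier (hti N)).measurable
            (mul_nonneg hC0 (Real.rpow_nonneg hnn _)) fun g hg => ?_
          rw [← convForm_measureFourier_eq (hti N) hg.integrable]
          exact hC _ _ hN hg
      _ = ENNReal.ofReal C * eLpNorm (truncate f N) (ENNReal.ofReal p) := by
          rw [h1, ENNReal.ofReal_mul hC0]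
      _ ≤ _ := by
          gcongr
          exact eLpNorm_mono (norm_truncate_le f N)

end Convolution

section SphereMeasure

variable {n : ℕ}

open scoped Pointwise in
theorem map_map_smul_toSphere (r : ℝ)
    (L : EuclideanSpace ℝ (Fin n) ≃ₗᵢ[ℝ] EuclideanSpace ℝ (Fin n)) :
    ((sphereMeasure n).map fun ε : Metric.sphere (0 : EuclideanSpace ℝ (Fin n)) 1 =>
      r • (ε : EuclideanSpace ℝ (Fin n))).map L =
      (sphereMeasure n).map fun ε : Metric.sphere (0 : EuclideanSpace ℝ (Fin n)) 1 =>
        r • (ε : EuclideanSpace ℝ (Fin n)) := by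
  have hφ : Measurable fun ε : Metric.sphere (0 : EuclideanSpace ℝ (Fin n)) 1 =>
      r • (ε : EuclideanSpace ℝ (Fin n)) := by fun_prop
  have hL : Measurable L := L.continuous.measurable
  ext s hs
  rw [Measure.map_apply hL hs, Measure.map_apply hφ (hL hs), Measure.map_apply hφ hs,
    sphereMeasure, Measure.toSphere_apply' _ (hφ (hL hs)), Measure.toSphere_apply' _ (hφ hs)]
  congr 1
  refine Eq.trans (congrArg volume ?_) (L.measurePreserving.measure_preimage_equiv
    (f := L.toHomeomorph.toMeasurableEquiv) _)
  change _ = L ⁻¹' _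
  ext x
  simp only [Set.mem_smul, Set.mem_image, Set.mem_preimage]
  constructor
  · rintro ⟨t, ht, _, ⟨ε, hε, rfl⟩, rfl⟩
    refine ⟨t, ht, L ε, ⟨⟨L ε, by simp⟩, ?_, rfl⟩, (map_smul L t _).symm⟩
    rwa [← map_smul]
  · rintro ⟨t, ht, _, ⟨ε, hε, rfl⟩, hx⟩
    refine ⟨t, ht, L.symm ε, ⟨⟨L.symm ε, by simp⟩, ?_, rfl⟩, ?_⟩
    · simpa using hε
    · apply L.injective
      rw [map_smul, L.apply_symm_apply]
      exact hx

theorem isSpherical_sphereMeasureR {r : ℝ} (hr : 0 < r) : IsSpherical (sphereMeasureR n r) r := by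
  have hφ : Measurable fun ε : Metric.sphere (0 : EuclideanSpace ℝ (Fin n)) 1 =>
      r • (ε : EuclideanSpace ℝ (Fin n)) := by fun_prop
  refine ⟨?_, fun L => ?_⟩
  · refine Measure.ae_smul_measure ?_ _
    rw [ae_map_iff hφ.aemeasurable (measurableSet_eq_fun measurable_norm measurable_const)]
    refine Filter.Eventually.of_forall fun ε => ?_
    rw [norm_smul, Real.norm_of_nonneg hr.le, norm_eq_of_mem_sphere, mul_one]
  · rw [sphereMeasureR, Measure.map_smul, map_map_smul_toSphere]

theorem isFiniteMeasure_sphereMeasureR (r : ℝ) : IsFiniteMeasure (sphereMeasureR n r) := by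
  have : IsFiniteMeasure (sphereMeasure n) := by unfold sphereMeasure; infer_instance
  unfold sphereMeasureR
  exact Measure.smul_finite _ ENNReal.ofReal_ne_top

theorem integral_sub_mul_invFTsphere (r : ℝ) (f : EuclideanSpace ℝ (Fin n) → ℂ)
    (x : EuclideanSpace ℝ (Fin n)) :
    ∫ y, f (x - y) * invFTsphere n r y =
      ∫ y, measureFourier (sphereMeasureR n r) (x - y) * f y := by
  rw [← integral_sub_left_eq_self _ volume x]
  congr 1; ext y
  rw [sub_sub_cancel, mul_comm]
  rfl

end SphereMeasure

end

theorem stein_tomas_dual (n : ℕ) (hn : 2 ≤ n) (p p' : ℝ≥0∞) (hp1 : 1 ≤ p)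
    (hp2 : p ≤ (2 * (n : ℝ≥0∞) + 2) / ((n : ℝ≥0∞) + 3)) (hpp' : 1 / p + 1 / p' = 1)
    (r : ℝ) (hr : 0 < r) :
    ∃ C > (0 : ℝ), ∀ f : SchwartzMap (EuclideanSpace ℝ (Fin n)) ℂ,
      eLpNorm (fun x => ∫ y : EuclideanSpace ℝ (Fin n), f (x - y) * invFTsphere n r y) p' volume ≤
        ENNReal.ofReal C * eLpNorm (⇑f) p volume := by
  have hfin := isFiniteMeasure_sphereMeasureR (n := n) r
  have hsph := isSpherical_sphereMeasureR (n := n) hr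
  have hn1 : 1 ≤ n := by omega
  simp_rw [integral_sub_mul_invFTsphere]
  rcases hp1.eq_or_lt with rfl | hp1
  · have hp' : p' = ∞ := by simpa using hpp'
    refine ⟨(sphereMeasureR n r).real Set.univ + 1, by positivity, fun f => ?_⟩
    have hf : Integrable f := f.integrable
    rw [hp', eLpNorm_exponent_top, eLpNorm_one_eq_lintegral_enorm,
      ← ofReal_integral_norm_eq_lintegral_enorm hf, ← ENNReal.ofReal_mul (by positivity)]
    refine eLpNormEssSup_le_of_ae_bound (Filter.Eventually.of_forall fun x => ?_)
    refine (norm_integral_measureFourier_le hf x).trans ?_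
    exact mul_le_mul_of_nonneg_right (by linarith) (integral_nonneg fun y => norm_nonneg _)
  · have hden : (2 * (n : ℝ≥0∞) + 2) / ((n : ℝ≥0∞) + 3) =
        ENNReal.ofReal ((2 * n + 2) / (n + 3)) := by
      rw [ENNReal.ofReal_div_of_pos (by positivity), ENNReal.ofReal_add (by positivity) (by simp),
        ENNReal.ofReal_add (by positivity) (by simp), ENNReal.ofReal_mul (by simp)]
      simp
    rw [hden] at hp2
    have hp_top : p ≠ ∞ := ne_top_of_le_ne_top ENNReal.ofReal_ne_top hp2
    lift p to NNReal using hp_top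
    have hp1r : 1 < (p : ℝ) := by exact_mod_cast hp1
    have hp3 : (p : ℝ) * (n + 3) ≤ 2 * n + 2 := by
      rw [← le_div_iff₀ (by positivity)]
      rwa [← ENNReal.ofReal_coe_nnreal, ENNReal.ofReal_le_ofReal_iff (by positivity)] at hp2
    have hp2r : (p : ℝ) < 2 := by
      have : (0 : ℝ) ≤ n := n.cast_nonneg
      nlinarith
    have hpinv : 1 / (p : ℝ≥0∞) < 1 := by
      rw [one_div]
      exact ENNReal.inv_lt_one.2 hp1
    have hp'top : p' ≠ ∞ := by
      rintro rfl
      rw [ENNReal.div_top, add_zero] at hpp'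
      exact hpinv.ne hpp'
    have hp'0 : p' ≠ 0 := by
      rintro rfl
      simp at hpp'
    lift p' to NNReal using hp'top
    have hq0 : 0 < (p' : ℝ) := by
      have : p' ≠ 0 := by exact_mod_cast hp'0
      exact_mod_cast pos_iff_ne_zero.2 this
    have hpq : (p : ℝ).HolderConjugate p' := by
      rw [Real.holderConjugate_iff]
      refine ⟨hp1r, ?_⟩
      have := congrArg ENNReal.toReal hpp'
      rw [ENNReal.toReal_add hpinv.ne_top (by simp [hp'0])] at this
      simpa using this
    obtain ⟨C, hC0, hC⟩ :=
      exists_eLpNorm_integral_measureFourier_le hsph hr hn1 hpq hp2r hp3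
    simp_rw [ENNReal.ofReal_coe_nnreal] at hC
    refine ⟨C + 1, by linarith, fun f => ?_⟩
    refine (hC f f.continuous.measurable f.integrable (f.memLp _)).trans ?_
    gcongr
    linarith
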